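/- Let q be a prime power. As n → ∞, the proportion ss_A(n,q) of semisimple elements of the affine group A(n,q) converges to [∏_{r ≥ 1, r ≡ 0, ±1 (mod 5)} (1 − 1/q^r)] · [∏_{r ≥ 1, r ≡ 0, ±2 (mod 5)} (1 − 1/q^{r−1})] / [∏_{r ≥ 1, r ≡ 0, ±2 (mod 5)} (1 − 1/q^r)]^2. -/

import Mathlib

open Matrix

/-- Membership in the affine group `A(n,q)`: invertible `(n+1) × (n+1)` matrices with
`x_{11} = 1` and `x_{j1} = 0` for `j ≥ 2` (indices starting at `0` in Lean). -/
def IsAff {F : Type} [Field F] {n : ℕ} (x : GL (Fin (n + 1)) F) : Prop :=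
  x.val 0 0 = 1 ∧ ∀ j : Fin (n + 1), j ≠ 0 → x.val j 0 = 0

/-- `ss_A(n,q)`: the proportion of semisimple elements (squarefree minimal polynomial;
over a perfect field this is equivalent to diagonalizability over the algebraic closure)
of the affine group `A(n,q)`. -/
noncomputable def ssA (F : Type) [Field F] [Fintype F] (n : ℕ) : ℝ :=
  (Nat.card {x : GL (Fin (n + 1)) F // IsAff x ∧ Squarefree (minpoly F x.val)} : ℝ) /
    (Nat.card {x : GL (Fin (n + 1)) F // IsAff x} : ℝ)

section

open Finset Filter Topology

/-- The reciprocal `1 / (x; x)_k` of the `q`-Pochhammer symbol, extended by zero to `k < 0`. -/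
noncomputable def invPoch (x : ℝ) (k : ℤ) : ℝ :=
  if 0 ≤ k then (∏ i ∈ range k.toNat, (1 - x ^ (i + 1)))⁻¹ else 0

/-- The triangular number `m (m - 1) / 2`. -/
def tri (m : ℤ) : ℤ := m * (m - 1) / 2

lemma two_mul_tri (m : ℤ) : 2 * tri m = m * (m - 1) := by
  have h : (2 : ℤ) ∣ m * (m - 1) := by
    have := Int.even_mul_succ_self (m - 1)
    rw [sub_add_cancel, mul_comm] at this
    exact this.two_dvd
  exact Int.mul_ediv_cancel' h

lemma tri_add_one (m : ℤ) : tri (m + 1) = tri m + m := by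
  have h1 := two_mul_tri m
  have h2 := two_mul_tri (m + 1)
  nlinarith

lemma invPoch_of_neg (x : ℝ) {k : ℤ} (hk : k < 0) : invPoch x k = 0 := by
  simp [invPoch, not_le.mpr hk]

lemma invPoch_zero (x : ℝ) : invPoch x 0 = 1 := by simp [invPoch]

lemma invPoch_natCast (x : ℝ) (k : ℕ) :
    invPoch x k = (∏ i ∈ range k, (1 - x ^ (i + 1)))⁻¹ := by simp [invPoch]

lemma one_sub_pow_pos {x : ℝ} (h0 : 0 < x) (h1 : x < 1) {k : ℕ} (hk : k ≠ 0) :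
    0 < 1 - x ^ k := by
  have := pow_lt_one₀ h0.le h1 hk
  linarith

lemma invPoch_mul {x : ℝ} (h0 : 0 < x) (h1 : x < 1) (k : ℤ) :
    invPoch x k * (1 - x ^ k) = invPoch x (k - 1) := by
  rcases lt_trichotomy k 0 with h | rfl | h
  · rw [invPoch_of_neg x h, invPoch_of_neg x (by omega), zero_mul]
  · simp [invPoch_of_neg]
  · obtain ⟨n, rfl⟩ : ∃ n : ℕ, k = n + 1 := ⟨(k - 1).toNat, by omega⟩
    rw [add_sub_cancel_right, show (n : ℤ) + 1 = ((n + 1 : ℕ) : ℤ) by push_cast; ring,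
      invPoch_natCast, invPoch_natCast, prod_range_succ, mul_inv, zpow_natCast]
    have := (one_sub_pow_pos h0 h1 (Nat.succ_ne_zero n)).ne'
    rw [mul_assoc, inv_mul_cancel₀ this, mul_one]

lemma summable_of_Icc_support {f : ℤ → ℝ} (a b : ℤ) (h : ∀ m, m < a ∨ b < m → f m = 0) :
    Summable f :=
  summable_of_ne_finset_zero (s := Icc a b) fun m hm => h m (by
    simp only [mem_Icc, not_and_or, not_le] at hm; exact hm)

lemma tsum_eq_sum_Icc {f : ℤ → ℝ} (a b : ℤ) (h : ∀ m, m < a ∨ b < m → f m = 0) :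
    ∑' m, f m = ∑ m ∈ Icc a b, f m :=
  tsum_eq_sum fun m hm => h m (by
    simp only [mem_Icc, not_and_or, not_le] at hm; exact hm)

/-- A form of the `q`-Vandermonde summation. -/
lemma tsum_invPoch_vandermonde {x : ℝ} (h0 : 0 < x) (h1 : x < 1) (K : ℕ) (b : ℤ) :
    ∑' t : ℤ, x ^ (t * (t + b)) * invPoch x (K - t) * invPoch x t * invPoch x (t + b)
      = invPoch x K * invPoch x (K + b) := by
  induction K generalizing b with
  | zero =>
    rw [tsum_eq_single 0]
    · simp [invPoch_zero]
    · intro t ht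
      rcases lt_or_gt_of_ne ht with h | h
      · simp [invPoch_of_neg x h]
      · simp [invPoch_of_neg x (show -t < 0 by omega)]
  | succ K ih =>
    have hK : (1 - x ^ ((K + 1 : ℕ) : ℤ)) ≠ 0 := by
      rw [zpow_natCast]; exact (one_sub_pow_pos h0 h1 K.succ_ne_zero).ne'
    apply mul_right_cancel₀ hK
    have key : ∀ t : ℤ,
        x ^ (t * (t + b)) * invPoch x ((K + 1 : ℕ) - t) * invPoch x t * invPoch x (t + b) *
          (1 - x ^ ((K + 1 : ℕ) : ℤ)) =
        x ^ (t * (t + b)) * invPoch x (K - t) * invPoch x t * invPoch x (t + b) +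
        x ^ ((K : ℤ) + 1 + b) * (x ^ ((t - 1) * (t - 1 + (b + 1))) * invPoch x (K - (t - 1)) *
          invPoch x (t - 1) * invPoch x (t - 1 + (b + 1))) := by
      intro t
      have e1 := invPoch_mul h0 h1 ((K + 1 : ℕ) - t)
      have e2 := invPoch_mul h0 h1 t
      have e3 : x ^ ((K + 1 : ℕ) : ℤ) = x ^ (((K + 1 : ℕ) : ℤ) - t) * x ^ t := by
        rw [← zpow_add₀ h0.ne']; congr 1; ring
      have e4 : x ^ ((K : ℤ) + 1 + b) * x ^ ((t - 1) * (t - 1 + (b + 1))) =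
          x ^ (((K + 1 : ℕ) : ℤ) - t) * x ^ (t * (t + b)) := by
        rw [← zpow_add₀ h0.ne', ← zpow_add₀ h0.ne']; congr 1; push_cast; ring
      have a1 : ((K + 1 : ℕ) : ℤ) - t - 1 = K - t := by push_cast; ring
      have a2 : (K : ℤ) - (t - 1) = (K + 1 : ℕ) - t := by push_cast; ring
      have a3 : t - 1 + (b + 1) = t + b := by ring
      rw [a1] at e1
      rw [a3] at e4
      rw [a2, a3, e3, ← e1, ← e2]
      linear_combination (-(invPoch x t * (1 - x ^ t) * invPoch x (((K + 1 : ℕ) : ℤ) - t)) *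
        invPoch x (t + b)) * e4
    rw [← tsum_mul_right, tsum_congr key, Summable.tsum_add, ih, tsum_mul_left]
    · have := (Equiv.subRight (1 : ℤ)).tsum_eq (fun t : ℤ => x ^ (t * (t + (b + 1))) *
        invPoch x (K - t) * invPoch x t * invPoch x (t + (b + 1)))
      simp only [Equiv.subRight_apply] at this
      rw [this, ih]
      have e1 := invPoch_mul h0 h1 ((K + 1 : ℕ) : ℤ)
      have e2 := invPoch_mul h0 h1 ((K : ℤ) + 1 + b)
      rw [show ((K + 1 : ℕ) : ℤ) - 1 = K by push_cast; ring] at e1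
      rw [show (K : ℤ) + 1 + b - 1 = K + b by ring] at e2
      rw [mul_right_comm, e1, ← e2]
      push_cast
      rw [show (K : ℤ) + (b + 1) = K + 1 + b by ring]
      ring
    · refine summable_of_Icc_support 0 K fun t ht => ?_
      rcases ht with h | h
      · simp [invPoch_of_neg x h]
      · simp [invPoch_of_neg x (show (K : ℤ) - t < 0 by omega)]
    · refine summable_of_Icc_support 0 (K + 1) fun t ht => ?_
      rcases ht with h | h
      · simp [invPoch_of_neg x (show t - 1 < 0 by omega)]
      · simp [invPoch_of_neg x (show (K : ℤ) - (t - 1) < 0 by omega)]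

lemma tsum_invPoch_conjugate {x : ℝ} (h0 : 0 < x) (h1 : x < 1) (N : ℕ) (a m : ℤ) :
    ∑' s : ℤ, x ^ (s * (s + a)) * invPoch x (N - s) * (invPoch x (s - m) * invPoch x (s + m + a))
      = x ^ (m * (m + a)) * (invPoch x (N - m) * invPoch x (N + m + a)) := by
  by_cases hm : (N : ℤ) - m < 0
  · rw [invPoch_of_neg x hm, zero_mul, mul_zero]
    convert tsum_zero with s
    rcases lt_or_ge (s - m) 0 with h | h
    · simp [invPoch_of_neg x h]
    · simp [invPoch_of_neg x (show (N : ℤ) - s < 0 by omega)]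
  · obtain ⟨K, hK⟩ : ∃ K : ℕ, (K : ℤ) = N - m := ⟨(N - m).toNat, by omega⟩
    have := tsum_invPoch_vandermonde h0 h1 K (2 * m + a)
    rw [← (Equiv.subRight m).tsum_eq] at this
    simp only [Equiv.subRight_apply] at this
    rw [← hK, show (N : ℤ) + m + a = K + (2 * m + a) by omega, ← this, ← tsum_mul_left]
    refine tsum_congr fun s => ?_
    rw [show s - m + (2 * m + a) = s + m + a by ring, show (K : ℤ) - (s - m) = N - s by omega,
      show s * (s + a) = m * (m + a) + (s - m) * (s + m + a) by ring, zpow_add₀ h0.ne']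
    ring

/-- One step of the Bailey chain. -/
lemma bailey_step {x : ℝ} (h0 : 0 < x) (h1 : x < 1) (α β : ℤ → ℝ) {a : ℤ} (ha0 : 0 ≤ a)
    (ha1 : a ≤ 1) (hβ : ∀ s, β s = ∑' m, α m * (invPoch x (s - m) * invPoch x (s + m + a)))
    (N : ℕ) :
    ∑' s : ℤ, x ^ (s * (s + a)) * invPoch x (N - s) * β s =
      ∑' m : ℤ, α m * x ^ (m * (m + a)) * (invPoch x (N - m) * invPoch x (N + m + a)) := by
  have hz : ∀ s m : ℤ, s ≤ N → (m < -N - a ∨ N < m) →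
      invPoch x (s - m) * invPoch x (s + m + a) = 0 := by
    intro s m hs hm
    rcases hm with h | h
    · rw [invPoch_of_neg x (show s + m + a < 0 by omega), mul_zero]
    · rw [invPoch_of_neg x (show s - m < 0 by omega), zero_mul]
  have hz' : ∀ s m : ℤ, s < 0 → invPoch x (s - m) * invPoch x (s + m + a) = 0 := by
    intro s m hs
    rcases lt_or_ge (s - m) 0 with h | h
    · rw [invPoch_of_neg x h, zero_mul]
    · rw [invPoch_of_neg x (show s + m + a < 0 by omega), mul_zero]
  rw [tsum_eq_sum_Icc 0 N, tsum_eq_sum_Icc (-N - a) N]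
  · have : ∀ s ∈ Icc (0 : ℤ) N, x ^ (s * (s + a)) * invPoch x (N - s) * β s =
        ∑ m ∈ Icc (-N - a : ℤ) N, α m * (x ^ (s * (s + a)) * invPoch x (N - s) *
          (invPoch x (s - m) * invPoch x (s + m + a))) := by
      intro s hs
      rw [mem_Icc] at hs
      rw [hβ, tsum_eq_sum_Icc (-N - a) N, mul_sum]
      · exact sum_congr rfl fun _ _ => by ring
      · intro m hm
        rw [hz s m hs.2 hm, mul_zero]
    rw [sum_congr rfl this, sum_comm]
    refine sum_congr rfl fun m _ => ?_
    rw [← mul_sum, mul_assoc, ← tsum_invPoch_conjugate h0 h1, tsum_eq_sum_Icc 0 N]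
    rintro s (h | h)
    · rw [hz' s m h, mul_zero]
    · rw [invPoch_of_neg x (show (N : ℤ) - s < 0 by omega)]; ring
  · intro m hm
    rw [hz N m le_rfl hm, mul_zero]
  · rintro s (h | h)
    · rw [hβ]
      simp [hz' s _ h]
    · rw [invPoch_of_neg x (show (N : ℤ) - s < 0 by omega)]; ring

/-- The finite Jacobi triple product. -/
lemma tsum_finite_triple_product {x z : ℝ} (h0 : 0 < x) (h1 : x < 1) (hz : z ≠ 0) (A B : ℕ) :
    ∑' m : ℤ, (-z) ^ m * x ^ tri m * (invPoch x (A - m) * invPoch x (B + m)) =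
      invPoch x (A + B) * ((∏ i ∈ range A, (1 - z * x ^ i)) *
        ∏ i ∈ range B, (1 - x ^ (i + 1) / z)) := by
  have hz' : -z ≠ 0 := neg_ne_zero.mpr hz
  have hsum : ∀ A B : ℤ, Summable fun m : ℤ =>
      (-z) ^ m * x ^ tri m * (invPoch x (A - m) * invPoch x (B + m)) := by
    intro A B
    refine summable_of_Icc_support (-B) A ?_
    rintro m (h | h)
    · rw [invPoch_of_neg x (show B + m < 0 by omega)]; ring
    · rw [invPoch_of_neg x (show A - m < 0 by omega)]; ring
  induction A with
  | zero =>
    induction B with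
    | zero =>
      rw [tsum_eq_single 0]
      · simp [invPoch_zero, tri]
      · intro t ht
        rcases lt_or_gt_of_ne ht with h | h
        · simp [invPoch_of_neg x h]
        · simp [invPoch_of_neg x (show - t < 0 by omega)]
    | succ B ih =>
      have hK : (1 - x ^ (((0 : ℕ) : ℤ) + (B + 1 : ℕ))) ≠ 0 := by
        rw [Nat.cast_zero, zero_add, zpow_natCast]
        exact (one_sub_pow_pos h0 h1 B.succ_ne_zero).ne'
      apply mul_left_cancel₀ hK
      have key : ∀ m : ℤ, (1 - x ^ (((0 : ℕ) : ℤ) + (B + 1 : ℕ))) *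
          ((-z) ^ m * x ^ tri m * (invPoch x ((0 : ℕ) - m) * invPoch x ((B + 1 : ℕ) + m))) =
          (-z) ^ m * x ^ tri m * (invPoch x ((0 : ℕ) - m) * invPoch x (B + m)) -
          x ^ (B + 1) / z * ((-z) ^ (m + 1) * x ^ tri (m + 1) *
            (invPoch x ((0 : ℕ) - (m + 1)) * invPoch x (B + (m + 1)))) := by
        intro m
        have e1 := invPoch_mul h0 h1 ((0 : ℕ) - m)
        have e2 := invPoch_mul h0 h1 ((B + 1 : ℕ) + m)
        rw [show ((B + 1 : ℕ) : ℤ) + m - 1 = B + m by push_cast; ring] at e2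
        rw [show ((0 : ℕ) : ℤ) - (m + 1) = (0 : ℕ) - m - 1 by ring, ← e1, ← e2,
          show (B : ℤ) + (m + 1) = (B + 1 : ℕ) + m by push_cast; ring, tri_add_one,
          zpow_add_one₀ hz', Nat.cast_zero, zero_add, zero_sub, _root_.zpow_neg,
          zpow_add₀ h0.ne', zpow_add₀ h0.ne', zpow_natCast]
        have := zpow_ne_zero m h0.ne'
        field_simp
        ring
      rw [← tsum_mul_left, tsum_congr key, Summable.tsum_sub (hsum _ _), ih, tsum_mul_left]
      · have := (Equiv.addRight (1 : ℤ)).tsum_eq (fun m : ℤ => (-z) ^ m * x ^ tri m *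
            (invPoch x ((0 : ℕ) - m) * invPoch x (B + m)))
        simp only [Equiv.coe_addRight] at this
        have e := invPoch_mul h0 h1 (((0 : ℕ) : ℤ) + (B + 1 : ℕ))
        rw [show ((0 : ℕ) : ℤ) + (B + 1 : ℕ) - 1 = (0 : ℕ) + B by push_cast; ring] at e
        rw [this, ih, prod_range_succ, ← e]
        ring
      · exact ((Equiv.addRight (1 : ℤ)).summable_iff.mpr (hsum (0 : ℕ) B)).mul_left _
  | succ A ih =>
    have hK : (1 - x ^ (((A + 1 : ℕ) : ℤ) + B)) ≠ 0 := by
      rw [← Nat.cast_add, zpow_natCast]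
      exact (one_sub_pow_pos h0 h1 (by omega)).ne'
    apply mul_left_cancel₀ hK
    have key : ∀ m : ℤ, (1 - x ^ (((A + 1 : ℕ) : ℤ) + B)) *
        ((-z) ^ m * x ^ tri m * (invPoch x ((A + 1 : ℕ) - m) * invPoch x (B + m))) =
        (-z) ^ m * x ^ tri m * (invPoch x (A - m) * invPoch x (B + m)) -
        z * x ^ A * ((-z) ^ (m - 1) * x ^ tri (m - 1) *
          (invPoch x (A - (m - 1)) * invPoch x (B + (m - 1)))) := by
      intro m
      have e1 := invPoch_mul h0 h1 ((A + 1 : ℕ) - m)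
      have e2 := invPoch_mul h0 h1 (B + m)
      have e3 := tri_add_one (m - 1)
      rw [sub_add_cancel] at e3
      rw [show ((A + 1 : ℕ) : ℤ) - m - 1 = A - m by push_cast; ring] at e1
      rw [show (B : ℤ) + (m - 1) = B + m - 1 by ring, ← e1, ← e2, e3,
        show (A : ℤ) - (m - 1) = (A + 1 : ℕ) - m by push_cast; ring,
        zpow_add₀ h0.ne', zpow_sub_one₀ hz', zpow_sub₀ h0.ne',
        zpow_add₀ h0.ne', zpow_add₀ h0.ne', zpow_sub_one₀ h0.ne', zpow_natCast, zpow_natCast, pow_succ]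
      have := zpow_ne_zero m h0.ne'
      field_simp
      ring
    rw [← tsum_mul_left, tsum_congr key, Summable.tsum_sub (hsum _ _), ih, tsum_mul_left]
    · have := (Equiv.subRight (1 : ℤ)).tsum_eq (fun m : ℤ => (-z) ^ m * x ^ tri m *
          (invPoch x (A - m) * invPoch x (B + m)))
      simp only [Equiv.subRight_apply] at this
      have e := invPoch_mul h0 h1 (((A + 1 : ℕ) : ℤ) + B)
      rw [show ((A + 1 : ℕ) : ℤ) + B - 1 = A + B by push_cast; ring] at e
      rw [this, ih, prod_range_succ, ← e]
      ring
    · exact ((Equiv.subRight (1 : ℤ)).summable_iff.mpr (hsum A B)).mul_left _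

end

section

open Finset Filter Topology

/-- The infinite product `∏_{i ≥ 0} (1 - x ^ (a i + b))`. -/
noncomputable def progProd (x : ℝ) (a b : ℕ) : ℝ := ∏' i : ℕ, (1 - x ^ (a * i + b))

lemma summable_pow_prog {x : ℝ} (h0 : 0 < x) (h1 : x < 1) {a : ℕ} (ha : a ≠ 0) (b : ℕ) :
    Summable fun i : ℕ => x ^ (a * i + b) := by
  have : Summable fun i : ℕ => (x ^ a) ^ i * x ^ b :=
    (summable_geometric_of_lt_one (pow_nonneg h0.le a) (pow_lt_one₀ h0.le h1 ha)).mul_right _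
  simpa only [pow_add, pow_mul] using this

lemma multipliable_progProd {x : ℝ} (h0 : 0 < x) (h1 : x < 1) {a : ℕ} (ha : a ≠ 0) (b : ℕ) :
    Multipliable fun i : ℕ => 1 - x ^ (a * i + b) := by
  simpa only [sub_eq_add_neg] using
    Real.multipliable_one_add_of_summable (summable_pow_prog h0 h1 ha b).neg

lemma tendsto_progProd {x : ℝ} (h0 : 0 < x) (h1 : x < 1) {a : ℕ} (ha : a ≠ 0) (b : ℕ) :
    Tendsto (fun N => ∏ i ∈ range N, (1 - x ^ (a * i + b))) atTop (𝓝 (progProd x a b)) :=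
  (multipliable_progProd h0 h1 ha b).tendsto_prod_tprod_nat

lemma progProd_pos {x : ℝ} (h0 : 0 < x) (h1 : x < 1) {a b : ℕ} (ha : a ≠ 0) (hb : b ≠ 0) :
    0 < progProd x a b := by
  refine lt_of_le_of_ne (ge_of_tendsto' (tendsto_progProd h0 h1 ha b) fun N =>
    prod_nonneg fun i _ => (one_sub_pow_pos h0 h1 (by omega)).le) (Ne.symm ?_)
  unfold progProd
  simp only [sub_eq_add_neg]
  refine tprod_one_add_ne_zero_of_summable (fun i => ?_) ?_
  · have := one_sub_pow_pos h0 h1 (k := a * i + b) (by omega)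
    rw [← sub_eq_add_neg]
    exact this.ne'
  · simpa [abs_of_pos h0] using summable_pow_prog h0 h1 ha b

lemma prod_range_five_mul (f : ℕ → ℝ) (N : ℕ) :
    ∏ r ∈ range (5 * N), f r =
      ∏ i ∈ range N, (f (5 * i) * f (5 * i + 1) * f (5 * i + 2) * f (5 * i + 3) *
        f (5 * i + 4)) := by
  induction N with
  | zero => simp
  | succ N ih =>
    rw [prod_range_succ, ← ih, show 5 * (N + 1) = 5 * N + 1 + 1 + 1 + 1 + 1 by ring]
    simp only [prod_range_succ]
    ring_nf

lemma tendsto_five_mul : Tendsto (fun N : ℕ => 5 * N) atTop atTop :=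
  tendsto_id.const_mul_atTop' (by norm_num)

lemma progProd_one_one {x : ℝ} (h0 : 0 < x) (h1 : x < 1) :
    progProd x 1 1 = progProd x 5 1 * progProd x 5 2 * progProd x 5 3 * progProd x 5 4 *
      progProd x 5 5 := by
  have h := (tendsto_progProd h0 h1 one_ne_zero 1).comp tendsto_five_mul
  have e := fun b => tendsto_progProd h0 h1 (a := 5) (by norm_num) b
  refine tendsto_nhds_unique h (((((e 1).mul (e 2)).mul (e 3)).mul (e 4)).mul (e 5) |>.congr ?_)
  intro N
  simp only [Function.comp, prod_range_five_mul, ← prod_mul_distrib]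
  refine prod_congr rfl fun i _ => ?_
  ring_nf

lemma invPoch_natCast_pos {x : ℝ} (h0 : 0 < x) (h1 : x < 1) (k : ℕ) : 0 < invPoch x k := by
  rw [invPoch_natCast]
  exact inv_pos.mpr (prod_pos fun i _ => one_sub_pow_pos h0 h1 i.succ_ne_zero)

lemma invPoch_nonneg {x : ℝ} (h0 : 0 < x) (h1 : x < 1) (k : ℤ) : 0 ≤ invPoch x k := by
  rcases lt_or_ge k 0 with h | h
  · rw [invPoch_of_neg x h]
  · lift k to ℕ using h
    exact (invPoch_natCast_pos h0 h1 k).le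

lemma tendsto_invPoch_natCast {x : ℝ} (h0 : 0 < x) (h1 : x < 1) :
    Tendsto (fun N : ℕ => invPoch x N) atTop (𝓝 (progProd x 1 1)⁻¹) := by
  simp only [invPoch_natCast]
  have := (tendsto_progProd h0 h1 one_ne_zero 1).inv₀
    (progProd_pos h0 h1 one_ne_zero one_ne_zero).ne'
  simpa only [one_mul] using this

lemma tendsto_invPoch {x : ℝ} (h0 : 0 < x) (h1 : x < 1) (k : ℤ) :
    Tendsto (fun N : ℕ => invPoch x (N + k)) atTop (𝓝 (progProd x 1 1)⁻¹) := by
  have h : Tendsto (fun N : ℕ => ((N : ℤ) + k).toNat) atTop atTop := by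
    refine tendsto_atTop.mpr fun b => ?_
    filter_upwards [eventually_ge_atTop (b + k.natAbs)] with N hN
    omega
  refine ((tendsto_invPoch_natCast h0 h1).comp h).congr' ?_
  filter_upwards [eventually_ge_atTop k.natAbs] with N hN
  simp only [Function.comp]
  congr 1
  omega

lemma invPoch_le {x : ℝ} (h0 : 0 < x) (h1 : x < 1) (k : ℤ) :
    invPoch x k ≤ (progProd x 1 1)⁻¹ := by
  rcases lt_or_ge k 0 with h | h
  · rw [invPoch_of_neg x h]
    exact inv_nonneg.mpr (progProd_pos h0 h1 one_ne_zero one_ne_zero).le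
  · lift k to ℕ using h
    refine Monotone.ge_of_tendsto (monotone_nat_of_le_succ fun n => ?_)
      (tendsto_invPoch_natCast h0 h1) k
    have := invPoch_mul h0 h1 ((n + 1 : ℕ) : ℤ)
    rw [show ((n + 1 : ℕ) : ℤ) - 1 = n by push_cast; ring] at this
    rw [← this, zpow_natCast]
    have h2 := invPoch_natCast_pos h0 h1 (n + 1)
    have h3 := pow_pos h0 (n + 1)
    nlinarith

lemma summable_pow_natAbs {x : ℝ} (h0 : 0 < x) (h1 : x < 1) :
    Summable fun m : ℤ => x ^ m.natAbs := by
  have := summable_geometric_of_lt_one h0.le h1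
  exact Summable.of_nat_of_neg (by simpa using this) (by simpa using this)

lemma zpow_le_pow_natAbs {x : ℝ} (h0 : 0 < x) (h1 : x < 1) {m e : ℤ} (h : (m.natAbs : ℤ) ≤ e) :
    x ^ e ≤ x ^ m.natAbs := by
  rw [← zpow_natCast]
  exact zpow_le_zpow_right_of_le_one₀ h0 h1.le h

lemma natAbs_le_five_tri {k : ℤ} (hk1 : 1 ≤ k) (hk4 : k ≤ 4) (m : ℤ) :
    (m.natAbs : ℤ) ≤ 5 * tri m + k * m := by
  have h := two_mul_tri m
  rw [Int.natCast_natAbs]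
  rcases lt_trichotomy m 0 with hm | rfl | hm
  · rw [abs_of_neg hm]; nlinarith
  · simp [tri]
  · rw [abs_of_pos hm]; nlinarith

lemma norm_neg_one_zpow_mul {x : ℝ} (h0 : 0 < x) (m e : ℤ) : ‖(-1 : ℝ) ^ m * x ^ e‖ = x ^ e := by
  rw [norm_mul, norm_zpow, norm_neg, norm_one, _root_.one_zpow, one_mul, norm_zpow, Real.norm_of_nonneg h0.le]

/-- Passing to the limit in a sum `∑ α_m / ((x)_{N - m} (x)_{N + m + a})`. -/
lemma tendsto_tsum_invPoch_mul {x y : ℝ} (h0 : 0 < x) (h1 : x < 1) (hy0 : 0 < y) (hy1 : y < 1)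
    (a : ℤ) (α : ℤ → ℝ) (hα : ∀ m, ‖α m‖ ≤ y ^ m.natAbs) :
    Tendsto (fun N : ℕ => ∑' m : ℤ, α m * (invPoch x (N - m) * invPoch x (N + m + a))) atTop
      (𝓝 ((∑' m : ℤ, α m) * ((progProd x 1 1)⁻¹ * (progProd x 1 1)⁻¹))) := by
  rw [← tsum_mul_right]
  have hC : 0 ≤ (progProd x 1 1)⁻¹ :=
    inv_nonneg.mpr (progProd_pos h0 h1 one_ne_zero one_ne_zero).le
  refine tendsto_tsum_of_dominated_convergence
    ((summable_pow_natAbs hy0 hy1).mul_right ((progProd x 1 1)⁻¹ * (progProd x 1 1)⁻¹)) ?_ ?_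
  · intro m
    refine Tendsto.const_mul _ (Tendsto.mul ?_ ?_)
    · simpa only [sub_eq_add_neg] using tendsto_invPoch h0 h1 (-m)
    · simpa only [add_assoc] using tendsto_invPoch h0 h1 (m + a)
  · refine Eventually.of_forall fun N m => ?_
    rw [norm_mul, norm_mul, Real.norm_of_nonneg (invPoch_nonneg h0 h1 _),
      Real.norm_of_nonneg (invPoch_nonneg h0 h1 _)]
    exact mul_le_mul (hα m) (mul_le_mul (invPoch_le h0 h1 _) (invPoch_le h0 h1 _)
      (invPoch_nonneg h0 h1 _) hC) (mul_nonneg (invPoch_nonneg h0 h1 _) (invPoch_nonneg h0 h1 _))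
      (pow_nonneg hy0.le _)

/-- The Jacobi triple product, specialised to exponents in arithmetic progressions modulo `5`. -/
lemma tsum_triple_product {x : ℝ} (h0 : 0 < x) (h1 : x < 1) {k : ℕ} (hk1 : 1 ≤ k) (hk4 : k ≤ 4) :
    ∑' m : ℤ, (-1 : ℝ) ^ m * x ^ (5 * tri m + k * m) =
      progProd x 5 5 * progProd x 5 k * progProd x 5 (5 - k) := by
  have y0 : 0 < x ^ 5 := pow_pos h0 5
  have y1 : x ^ 5 < 1 := pow_lt_one₀ h0.le h1 (by norm_num)
  have hz : x ^ k ≠ 0 := (pow_pos h0 k).ne'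
  have hP := (progProd_pos y0 y1 (a := 1) one_ne_zero one_ne_zero).ne'
  have hP5 : progProd (x ^ 5) 1 1 = progProd x 5 5 := by
    unfold progProd
    refine tprod_congr fun i => ?_
    rw [← pow_mul]
    ring_nf
  have e := tendsto_tsum_invPoch_mul y0 y1 h0 h1 0
    (fun m => (-1 : ℝ) ^ m * x ^ (5 * tri m + k * m)) fun m => by
      rw [norm_neg_one_zpow_mul h0]
      exact zpow_le_pow_natAbs h0 h1 (natAbs_le_five_tri (by exact_mod_cast hk1)
        (by exact_mod_cast hk4) m)
  have f : ∀ N : ℕ, ∑' m : ℤ, (-1 : ℝ) ^ m * x ^ (5 * tri m + k * m) *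
      (invPoch (x ^ 5) (N - m) * invPoch (x ^ 5) (N + m + 0)) =
      invPoch (x ^ 5) ((2 * N : ℕ) : ℤ) * ((∏ i ∈ range N, (1 - x ^ (5 * i + k))) *
        ∏ i ∈ range N, (1 - x ^ (5 * i + (5 - k)))) := by
    intro N
    have := tsum_finite_triple_product y0 y1 hz N N
    rw [show (N : ℤ) + N = (2 * N : ℕ) by push_cast; ring] at this
    convert this using 1
    · refine tsum_congr fun m => ?_
      have hm : (-x ^ k) ^ m * (x ^ 5) ^ tri m = (-1 : ℝ) ^ m * x ^ (5 * tri m + k * m) := by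
        rw [neg_eq_neg_one_mul (x ^ k), mul_zpow, ← zpow_natCast x k, ← zpow_natCast x 5,
          ← _root_.zpow_mul, ← _root_.zpow_mul, mul_assoc, ← zpow_add₀ h0.ne', add_comm]
        rfl
      rw [add_zero, hm]
    · congr 2
      · refine prod_congr rfl fun i _ => ?_
        rw [← pow_mul]; ring
      · refine prod_congr rfl fun i _ => ?_
        rw [eq_comm, ← pow_mul, show 5 * (i + 1) = 5 * i + (5 - k) + k by omega, pow_add _ _ k,
          mul_div_assoc, div_self hz, mul_one]
  have g := ((tendsto_invPoch_natCast y0 y1).comp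
    (tendsto_id.const_mul_atTop' (show 0 < 2 by norm_num))).mul
    ((tendsto_progProd h0 h1 (a := 5) (by norm_num) k).mul
      (tendsto_progProd h0 h1 (a := 5) (by norm_num) (5 - k)))
  have := tendsto_nhds_unique (e.congr f) g
  rw [← hP5]
  field_simp at this
  linear_combination this

lemma tsum_unit_bailey {x : ℝ} (h0 : 0 < x) (h1 : x < 1) {a : ℕ} (ha : a ≤ 1) (s : ℤ) :
    (if s = 0 then (1 : ℝ) else 0) =
      ∑' m : ℤ, (-1 : ℝ) ^ m * x ^ tri m * (invPoch x (s - m) * invPoch x (s + m + a)) := by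
  rcases lt_or_ge s 0 with h | h
  · rw [if_neg h.ne]
    symm
    convert tsum_zero with m
    rcases lt_or_ge (s - m) 0 with h | h
    · rw [invPoch_of_neg x h]; ring
    · rw [invPoch_of_neg x (show s + m + a < 0 by omega)]; ring
  · lift s to ℕ using h
    have := tsum_finite_triple_product h0 h1 one_ne_zero s (s + a)
    rw [tsum_congr fun m : ℤ => by rw [show (s : ℤ) + m + a = (s + a : ℕ) + m by push_cast; ring],
      this]
    rcases Nat.eq_zero_or_pos s with rfl | hs
    · interval_cases a
      · simp [invPoch_zero]
      · have := invPoch_mul h0 h1 1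
        simp only [zpow_one, sub_self, invPoch_zero] at this
        simp [this]
    · rw [if_neg (by exact_mod_cast hs.ne'), prod_eq_zero (mem_range.mpr hs) (by simp)]
      ring

lemma tsum_bailey_one {x : ℝ} (h0 : 0 < x) (h1 : x < 1) {a : ℕ} (ha : a ≤ 1) (s : ℤ) :
    invPoch x s = ∑' m : ℤ, (-1 : ℝ) ^ m * x ^ tri m * x ^ (m * (m + a)) *
      (invPoch x (s - m) * invPoch x (s + m + a)) := by
  rcases lt_or_ge s 0 with h | h
  · rw [invPoch_of_neg x h]
    symm
    convert tsum_zero with m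
    rcases lt_or_ge (s - m) 0 with h | h
    · rw [invPoch_of_neg x h]; ring
    · rw [invPoch_of_neg x (show s + m + a < 0 by omega)]; ring
  · lift s to ℕ using h
    rw [← bailey_step h0 h1 _ _ (Nat.cast_nonneg a) (by exact_mod_cast ha)
      (tsum_unit_bailey h0 h1 ha), tsum_eq_single 0]
    · simp
    · intro t ht
      simp [ht]

lemma tsum_bailey_two {x : ℝ} (h0 : 0 < x) (h1 : x < 1) {a : ℕ} (ha : a ≤ 1) (N : ℕ) :
    ∑' s : ℤ, x ^ (s * (s + a)) * invPoch x (N - s) * invPoch x s =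
      ∑' m : ℤ, (-1 : ℝ) ^ m * x ^ (5 * tri m + (2 + 2 * a : ℕ) * m) *
        (invPoch x (N - m) * invPoch x (N + m + a)) := by
  rw [bailey_step h0 h1 _ _ (Nat.cast_nonneg a) (by exact_mod_cast ha)
      (tsum_bailey_one h0 h1 ha)]
  refine tsum_congr fun m => ?_
  have h := two_mul_tri m
  rw [mul_assoc ((-1 : ℝ) ^ m), mul_assoc ((-1 : ℝ) ^ m), ← zpow_add₀ h0.ne', ← zpow_add₀ h0.ne']
  congr 3
  push_cast
  linarith

lemma summable_rogersRamanujan {x : ℝ} (h0 : 0 < x) (h1 : x < 1) (a : ℕ) :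
    Summable fun n : ℕ => x ^ (n * (n + a)) * invPoch x n := by
  refine Summable.of_nonneg_of_le (fun n => mul_nonneg (pow_nonneg h0.le _)
    (invPoch_nonneg h0 h1 _)) (fun n => ?_)
    ((summable_geometric_of_lt_one h0.le h1).mul_right (progProd x 1 1)⁻¹)
  refine mul_le_mul ?_ (invPoch_le h0 h1 _) (invPoch_nonneg h0 h1 _) (pow_nonneg h0.le _)
  refine pow_le_pow_of_le_one h0.le h1.le ?_
  nlinarith [Nat.zero_le n, Nat.zero_le a, Nat.le_mul_self n]

lemma tsum_rogersRamanujan {x : ℝ} (h0 : 0 < x) (h1 : x < 1) {a : ℕ} (ha : a ≤ 1) :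
    (∑' n : ℕ, x ^ (n * (n + a)) * invPoch x n) * progProd x 1 1 =
      progProd x 5 5 * progProd x 5 (2 + 2 * a) * progProd x 5 (5 - (2 + 2 * a)) := by
  have hP := progProd_pos h0 h1 (a := 1) one_ne_zero one_ne_zero
  have e := tendsto_tsum_invPoch_mul h0 h1 h0 h1 a
    (fun m => (-1 : ℝ) ^ m * x ^ (5 * tri m + (2 + 2 * a : ℕ) * m)) fun m => by
      rw [norm_neg_one_zpow_mul h0]
      exact zpow_le_pow_natAbs h0 h1 (natAbs_le_five_tri (by push_cast; omega)
        (by push_cast; omega) m)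
  rw [tsum_triple_product h0 h1 (by omega) (by omega)] at e
  have e' := e.congr fun N => (tsum_bailey_two h0 h1 ha N).symm
  have hcast : ∀ N : ℕ, ∑' s : ℤ, x ^ (s * (s + a)) * invPoch x (N - s) * invPoch x s =
      ∑' n : ℕ, x ^ (n * (n + a)) * invPoch x n * invPoch x (N - n) := by
    intro N
    rw [← Function.Injective.tsum_eq (Nat.cast_injective (R := ℤ))]
    · refine tsum_congr fun n => ?_
      rw [← zpow_natCast x]
      push_cast
      ring
    · intro s hs
      rw [Function.mem_support] at hs
      refine ⟨s.toNat, ?_⟩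
      by_contra h
      exact hs (by rw [invPoch_of_neg x (show s < 0 by omega), mul_zero])
  have f : Tendsto (fun N : ℕ => ∑' n : ℕ, x ^ (n * (n + a)) * invPoch x n * invPoch x (N - n))
      atTop (𝓝 (∑' n : ℕ, x ^ (n * (n + a)) * invPoch x n * (progProd x 1 1)⁻¹)) := by
    refine tendsto_tsum_of_dominated_convergence
      ((summable_rogersRamanujan h0 h1 a).mul_right (progProd x 1 1)⁻¹) ?_ ?_
    · intro n
      refine Tendsto.const_mul _ ?_
      simpa only [sub_eq_add_neg] using tendsto_invPoch h0 h1 (-n)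
    · refine Eventually.of_forall fun N n => ?_
      have h2 := mul_nonneg (pow_nonneg h0.le (n * (n + a))) (invPoch_nonneg h0 h1 n)
      rw [Real.norm_of_nonneg (mul_nonneg h2 (invPoch_nonneg h0 h1 _))]
      exact mul_le_mul_of_nonneg_left (invPoch_le h0 h1 _) h2
  have := tendsto_nhds_unique (e'.congr hcast) f
  rw [tsum_mul_right] at this
  field_simp at this
  linear_combination -this

/-- The first Rogers–Ramanujan identity. -/
lemma rogersRamanujan_one {x : ℝ} (h0 : 0 < x) (h1 : x < 1) :
    ∑' n : ℕ, x ^ (n * (n + 0)) * invPoch x n = (progProd x 5 1 * progProd x 5 4)⁻¹ := by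
  have h := tsum_rogersRamanujan h0 h1 (zero_le_one : 0 ≤ 1)
  have p := fun b hb => (progProd_pos h0 h1 (a := 5) (b := b) (by norm_num) hb).ne'
  have p1 := p 1 (by norm_num); have p2 := p 2 (by norm_num); have p3 := p 3 (by norm_num)
  have p4 := p 4 (by norm_num); have p5 := p 5 (by norm_num)
  rw [progProd_one_one h0 h1] at h
  norm_num at h ⊢
  field_simp
  apply mul_right_cancel₀ (mul_ne_zero (mul_ne_zero p5 p2) p3)
  linear_combination h

/-- The second Rogers–Ramanujan identity. -/
lemma rogersRamanujan_two {x : ℝ} (h0 : 0 < x) (h1 : x < 1) :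
    ∑' n : ℕ, x ^ (n * (n + 1)) * invPoch x n = (progProd x 5 2 * progProd x 5 3)⁻¹ := by
  have h := tsum_rogersRamanujan h0 h1 (le_refl 1)
  have p := fun b hb => (progProd_pos h0 h1 (a := 5) (b := b) (by norm_num) hb).ne'
  have p1 := p 1 (by norm_num); have p2 := p 2 (by norm_num); have p3 := p 3 (by norm_num)
  have p4 := p 4 (by norm_num); have p5 := p 5 (by norm_num)
  rw [progProd_one_one h0 h1] at h
  norm_num at h ⊢
  field_simp
  apply mul_right_cancel₀ (mul_ne_zero (mul_ne_zero p5 p4) p1)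
  linear_combination h

end

section

open Polynomial

/-- The order of the general linear group of rank `n` over a field with `q` elements. -/
def glOrd (q n : ℕ) : ℕ := ∏ i : Fin n, (q ^ n - q ^ (i : ℕ))

lemma glOrd_pos {q : ℕ} (hq : 1 < q) (n : ℕ) : 0 < glOrd q n :=
  Finset.prod_pos fun i _ => Nat.sub_pos_of_lt (Nat.pow_lt_pow_right hq i.2)

lemma Nat.card_eq_mul_of_fiber {X Y : Type*} [Finite X] [Finite Y] (f : X → Y) (c : ℕ)
    (h : ∀ y, Nat.card {x // f x = y} = c) : Nat.card X = Nat.card Y * c := by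
  have := Fintype.ofFinite Y
  rw [← Nat.card_congr (Equiv.sigmaFiberEquiv f), Nat.card_sigma]
  simp [h]

section LinearAlgebra

variable {F : Type*} [Field F] [Finite F]

lemma card_linearEquiv {V W : Type*} [AddCommGroup V] [Module F V] [FiniteDimensional F V]
    [AddCommGroup W] [Module F W] [FiniteDimensional F W] {n : ℕ}
    (hV : Module.finrank F V = n) (hW : Module.finrank F W = n) :
    Nat.card (V ≃ₗ[F] W) = glOrd (Nat.card F) n := by
  have := Fintype.ofFinite F
  let eV : V ≃ₗ[F] (Fin n → F) := LinearEquiv.ofFinrankEq _ _ (by simp [hV])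
  let eW : W ≃ₗ[F] (Fin n → F) := LinearEquiv.ofFinrankEq _ _ (by simp [hW])
  let e1 : (V ≃ₗ[F] W) ≃ ((Fin n → F) ≃ₗ[F] (Fin n → F)) :=
    { toFun := fun e => eV.symm ≪≫ₗ e ≪≫ₗ eW
      invFun := fun e => eV ≪≫ₗ e ≪≫ₗ eW.symm
      left_inv := fun e => by ext; simp
      right_inv := fun e => LinearEquiv.ext fun x => by simp }
  rw [Nat.card_congr e1, ← Nat.card_congr
    (LinearMap.GeneralLinearGroup.generalLinearEquiv F (Fin n → F)).toEquiv,
    ← Nat.card_congr (Matrix.GeneralLinearGroup.toLin (n := Fin n) (R := F)).toEquiv,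
    Matrix.card_GL_field, Nat.card_eq_fintype_card]
  rfl

instance finite_linearMap {V W : Type*} [AddCommGroup V] [Module F V] [FiniteDimensional F V]
    [AddCommGroup W] [Module F W] [FiniteDimensional F W] : Finite (V →ₗ[F] W) :=
  have : Finite W := Module.finite_of_finite F
  have : Finite V := Module.finite_of_finite F
  DFunLike.finite _

instance finite_linearEquiv {V W : Type*} [AddCommGroup V] [Module F V] [FiniteDimensional F V]
    [AddCommGroup W] [Module F W] [FiniteDimensional F W] : Finite (V ≃ₗ[F] W) :=
  have : Finite W := Module.finite_of_finite F
  have : Finite V := Module.finite_of_finite F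
  DFunLike.finite _

/-- The number of endomorphisms of an `n`-dimensional space annihilated by the polynomial `P`. -/
noncomputable def annCard (P : F[X]) (n : ℕ) : ℕ :=
  Nat.card {A : Module.End F (Fin n → F) // aeval A P = 0}

omit [Finite F] in
lemma aeval_conjAlgEquiv {V W : Type*} [AddCommGroup V] [Module F V] [AddCommGroup W] [Module F W]
    (e : V ≃ₗ[F] W) (A : Module.End F V) (P : F[X]) :
    aeval (e.conjAlgEquiv F A) P = e.conjAlgEquiv F (aeval A P) :=
  aeval_algHom_apply (e.conjAlgEquiv F).toAlgHom A P

omit [Finite F] in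
lemma card_ann {V : Type*} [AddCommGroup V] [Module F V] [FiniteDimensional F V] {n : ℕ}
    (hV : Module.finrank F V = n) (P : F[X]) :
    Nat.card {A : Module.End F V // aeval A P = 0} = annCard P n := by
  let e : V ≃ₗ[F] (Fin n → F) := LinearEquiv.ofFinrankEq _ _ (by simp [hV])
  refine Nat.card_congr ((e.conjAlgEquiv F).toEquiv.subtypeEquiv fun A => ?_)
  have := aeval_conjAlgEquiv e A P
  simp [this]

omit [Finite F] in
lemma aeval_prodMap {V W : Type*} [AddCommGroup V] [Module F V] [AddCommGroup W] [Module F W]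
    (B : Module.End F V) (C : Module.End F W) (P : F[X]) :
    aeval (B.prodMap C) P = (aeval B P).prodMap (aeval C P) := by
  have := aeval_algHom_apply (LinearMap.prodMapAlgHom F V W) (B, C) P
  rw [aeval_prod_apply] at this
  exact this

omit [Finite F] in
lemma conj_symm_aeval_apply {V W : Type*} [AddCommGroup V] [Module F V] [AddCommGroup W]
    [Module F W] (e : V ≃ₗ[F] W) (D : Module.End F W) (R : F[X]) (v : V) :
    aeval (e.symm.conjAlgEquiv F D) R v = e.symm (aeval D R (e v)) := by
  rw [aeval_conjAlgEquiv]; rfl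

omit [Finite F] in
lemma aeval_apply_eq_zero_of_isCoprime {T : Type*} [AddCommGroup T] [Module F T]
    (D : Module.End F T) {P Q : F[X]} (h : IsCoprime P Q) (hD : aeval D Q = 0) (x : T)
    (hx : aeval D P x = 0) : x = 0 := by
  obtain ⟨a, b, hab⟩ := h
  have := congrArg (fun R => aeval D R x) hab
  simpa [hx, hD] using this.symm

omit [Finite F] in
lemma aeval_prodMap_apply_left {U W : Type*} [AddCommGroup U] [Module F U] [AddCommGroup W]
    [Module F W] {P Q : F[X]} (hPQ : IsCoprime P Q) {B : Module.End F U} {C : Module.End F W}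
    (hB : aeval B P = 0) (hC : aeval C Q = 0) (x : U × W) :
    aeval (B.prodMap C) P x = 0 ↔ x.2 = 0 := by
  rw [aeval_prodMap]
  simp only [hB, LinearMap.prodMap_apply, LinearMap.zero_apply, Prod.mk_eq_zero, true_and]
  exact ⟨aeval_apply_eq_zero_of_isCoprime C hPQ hC _, fun h => by simp [h]⟩

omit [Finite F] in
lemma aeval_prodMap_apply_right {U W : Type*} [AddCommGroup U] [Module F U] [AddCommGroup W]
    [Module F W] {P Q : F[X]} (hPQ : IsCoprime P Q) {B : Module.End F U} {C : Module.End F W}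
    (hB : aeval B P = 0) (hC : aeval C Q = 0) (x : U × W) :
    aeval (B.prodMap C) Q x = 0 ↔ x.1 = 0 := by
  rw [aeval_prodMap]
  simp only [hC, LinearMap.prodMap_apply, LinearMap.zero_apply, Prod.mk_eq_zero, and_true]
  exact ⟨aeval_apply_eq_zero_of_isCoprime B hPQ.symm hB _, fun h => by simp [h]⟩

omit [Finite F] in
lemma finrank_ker_aeval_conj_prodMap {V U W : Type*} [AddCommGroup V] [Module F V]
    [AddCommGroup U] [Module F U] [AddCommGroup W]
    [Module F W] {P Q : F[X]} (hPQ : IsCoprime P Q) {B : Module.End F U} {C : Module.End F W}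
    (hB : aeval B P = 0) (hC : aeval C Q = 0) (e : V ≃ₗ[F] (U × W)) :
    Module.finrank F (LinearMap.ker (aeval (e.symm.conjAlgEquiv F (B.prodMap C)) P)) =
      Module.finrank F U := by
  have h1 : LinearMap.ker (aeval (e.symm.conjAlgEquiv F (B.prodMap C)) P) =
      (LinearMap.range (LinearMap.inl F U W)).map e.symm.toLinearMap := by
    ext v
    rw [LinearMap.mem_ker, conj_symm_aeval_apply, LinearEquiv.map_eq_zero_iff,
      aeval_prodMap_apply_left hPQ hB hC, Submodule.mem_map]
    constructor
    · intro h
      exact ⟨e v, ⟨(e v).1, by ext <;> simp [h]⟩, by simp⟩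
    · rintro ⟨_, ⟨u, rfl⟩, rfl⟩
      simp
  rw [h1, LinearEquiv.finrank_map_eq, LinearMap.finrank_range_of_inj LinearMap.inl_injective]

omit [Finite F] in
lemma aeval_restrict_ker {V : Type*} [AddCommGroup V] [Module F V] (A : Module.End F V)
    (P : F[X]) : ∃ h : ∀ x ∈ LinearMap.ker (aeval A P), A x ∈ LinearMap.ker (aeval A P),
      aeval (A.restrict h) P = 0 := by
  have inv : ∀ x ∈ LinearMap.ker (aeval A P), A x ∈ LinearMap.ker (aeval A P) := by
    intro x hx
    rw [LinearMap.mem_ker] at hx ⊢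
    have := congrArg (fun S => aeval A S x) (mul_comm P X)
    simpa [hx] using this
  refine ⟨inv, ?_⟩
  have res : ∀ (S : F[X]) (x : LinearMap.ker (aeval A P)),
      ((aeval (A.restrict inv) S x : LinearMap.ker (aeval A P)) : V) = aeval A S x := by
    intro S x
    induction S using Polynomial.induction_on' with
    | add p q hp hq => simp [hp, hq]
    | monomial n a =>
      simp only [aeval_monomial]
      rw [Module.End.mul_apply, Module.End.mul_apply, Module.algebraMap_end_apply,
        Module.algebraMap_end_apply, Submodule.coe_smul]
      congr 1
      induction n generalizing x with
      | zero => simp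
      | succ n ih => rw [pow_succ, pow_succ, Module.End.mul_apply, Module.End.mul_apply, ih]; rfl
  ext x
  rw [res]
  simp

omit [Finite F] in
lemma exists_conj_prodMap {V U W : Type*} [AddCommGroup V] [Module F V] [FiniteDimensional F V]
    [AddCommGroup U] [Module F U] [FiniteDimensional F U]
    [AddCommGroup W] [Module F W] [FiniteDimensional F W] {P Q : F[X]} (hPQ : IsCoprime P Q)
    (hV : Module.finrank F V = Module.finrank F U + Module.finrank F W)
    (A : Module.End F V) (hA : aeval A (P * Q) = 0)
    (hAi : Module.finrank F (LinearMap.ker (aeval A P)) = Module.finrank F U) :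
    ∃ (e : V ≃ₗ[F] (U × W)) (B : Module.End F U) (C : Module.End F W),
      aeval B P = 0 ∧ aeval C Q = 0 ∧ e.symm.conjAlgEquiv F (B.prodMap C) = A := by
  have hsup := sup_ker_aeval_eq_ker_aeval_mul_of_coprime A hPQ
  rw [hA, LinearMap.ker_zero] at hsup
  have hc : IsCompl (LinearMap.ker (aeval A P)) (LinearMap.ker (aeval A Q)) :=
    ⟨disjoint_ker_aeval_of_isCoprime A hPQ, codisjoint_iff.2 hsup⟩
  have hj : Module.finrank F (LinearMap.ker (aeval A Q)) = Module.finrank F W := by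
    have := Submodule.finrank_add_eq_of_isCompl hc
    omega
  obtain ⟨invP, hP⟩ := aeval_restrict_ker A P
  obtain ⟨invQ, hQ⟩ := aeval_restrict_ker A Q
  let eU : LinearMap.ker (aeval A P) ≃ₗ[F] U := LinearEquiv.ofFinrankEq _ _ hAi
  let eW : LinearMap.ker (aeval A Q) ≃ₗ[F] W := LinearEquiv.ofFinrankEq _ _ hj
  let s := Submodule.prodEquivOfIsCompl _ _ hc
  refine ⟨s.symm ≪≫ₗ eU.prodCongr eW, eU.conjAlgEquiv F (A.restrict invP),
    eW.conjAlgEquiv F (A.restrict invQ), ?_, ?_, ?_⟩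
  · rw [aeval_conjAlgEquiv, hP, map_zero]
  · rw [aeval_conjAlgEquiv, hQ, map_zero]
  · ext v
    obtain ⟨⟨x, y⟩, rfl⟩ := s.surjective v
    simp [LinearEquiv.conjAlgEquiv_apply, s]

lemma annCard_mul_aux {V U W : Type*} [AddCommGroup V] [Module F V] [FiniteDimensional F V]
    [AddCommGroup U] [Module F U] [FiniteDimensional F U]
    [AddCommGroup W] [Module F W] [FiniteDimensional F W] {P Q : F[X]} (hPQ : IsCoprime P Q)
    {i j : ℕ} (hU : Module.finrank F U = i) (hW : Module.finrank F W = j)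
    (hV : Module.finrank F V = i + j) :
    glOrd (Nat.card F) (i + j) * (annCard P i * annCard Q j) =
      Nat.card {A : Module.End F V // aeval A (P * Q) = 0 ∧
        Module.finrank F (LinearMap.ker (aeval A P)) = i} *
      (glOrd (Nat.card F) i * glOrd (Nat.card F) j) := by
  have hUW : Module.finrank F (U × W) = i + j := by simp [hU, hW]
  rw [← card_linearEquiv (F := F) hV hUW, ← card_ann hU, ← card_ann hW,
    ← card_linearEquiv (F := F) hU hU, ← card_linearEquiv (F := F) hW hW, ← Nat.card_prod,
    ← Nat.card_prod, ← Nat.card_prod]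
  let f : ((V ≃ₗ[F] (U × W)) × {A : Module.End F U // aeval A P = 0} ×
      {A : Module.End F W // aeval A Q = 0}) → {A : Module.End F V // aeval A (P * Q) = 0 ∧
        Module.finrank F (LinearMap.ker (aeval A P)) = i} := fun t =>
    ⟨t.1.symm.conjAlgEquiv F (t.2.1.1.prodMap t.2.2.1), by
      obtain ⟨e, ⟨B, hB⟩, ⟨C, hC⟩⟩ := t
      constructor
      · rw [aeval_conjAlgEquiv, aeval_prodMap]
        simp [hB, hC]
      · exact (finrank_ker_aeval_conj_prodMap hPQ hB hC e).trans hU⟩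
  refine Nat.card_eq_mul_of_fiber f _ ?_
  rintro ⟨A, hA, hAi⟩
  obtain ⟨e0, B0, C0, hB0, hC0, hA0⟩ :=
    exists_conj_prodMap (U := U) (W := W) hPQ (by omega) A hA (by omega)
  let Φ : ((U ≃ₗ[F] U) × (W ≃ₗ[F] W)) → {x // f x = ⟨A, hA, hAi⟩} := fun g =>
    ⟨(e0 ≪≫ₗ g.1.prodCongr g.2, ⟨g.1.conjAlgEquiv F B0, by rw [aeval_conjAlgEquiv, hB0, map_zero]⟩,
      ⟨g.2.conjAlgEquiv F C0, by rw [aeval_conjAlgEquiv, hC0, map_zero]⟩), by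
      refine Subtype.ext (Eq.trans ?_ hA0)
      ext v
      simp [f, LinearEquiv.conjAlgEquiv_apply]⟩
  refine (Nat.card_congr (Equiv.ofBijective Φ ⟨?_, ?_⟩)).symm
  · rintro ⟨g1, g2⟩ ⟨g1', g2'⟩ h
    have h1 : e0 ≪≫ₗ g1.prodCongr g2 = e0 ≪≫ₗ g1'.prodCongr g2' := congrArg (fun t => t.1.1) h
    have h2 : ∀ x, g1.prodCongr g2 x = g1'.prodCongr g2' x := by
      intro x
      have := LinearEquiv.congr_fun h1 (e0.symm x)
      simpa using this
    simp only [LinearEquiv.prodCongr_apply, Prod.mk.injEq] at h2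
    ext x
    · exact (h2 (x, 0)).1
    · exact (h2 (0, x)).2
  · rintro ⟨⟨e, ⟨B, hB⟩, ⟨C, hC⟩⟩, h⟩
    have hAe : e.symm.conjAlgEquiv F (B.prodMap C) = A := congrArg Subtype.val h
    set g : (U × W) ≃ₗ[F] (U × W) := e0.symm ≪≫ₗ e with hg
    have hgc : ∀ (R : F[X]) x, aeval (B.prodMap C) R (g x) = g (aeval (B0.prodMap C0) R x) := by
      intro R x
      have h1 := conj_symm_aeval_apply e (B.prodMap C) R (e0.symm x)
      have h2 := conj_symm_aeval_apply e0 (B0.prodMap C0) R (e0.symm x)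
      rw [hAe] at h1
      rw [hA0, h1] at h2
      have := congrArg e h2
      simpa [hg] using this
    have g2 : ∀ u, (g (u, 0)).2 = 0 := fun u => by
      rw [← aeval_prodMap_apply_left hPQ hB hC, hgc, (aeval_prodMap_apply_left hPQ hB0 hC0 _).2 rfl, map_zero]
    have g1 : ∀ w, (g (0, w)).1 = 0 := fun w => by
      rw [← aeval_prodMap_apply_right hPQ hB hC, hgc, (aeval_prodMap_apply_right hPQ hB0 hC0 _).2 rfl, map_zero]
    obtain ⟨a, ha⟩ : ∃ a : U ≃ₗ[F] U, ∀ u, a u = (g (u, 0)).1 := by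
      refine ⟨LinearEquiv.ofInjectiveEndo (LinearMap.fst F U W ∘ₗ g.toLinearMap ∘ₗ
        LinearMap.inl F U W) ?_, fun u => rfl⟩
      rw [injective_iff_map_eq_zero]
      intro u hu
      have : g (u, 0) = 0 := Prod.ext hu (g2 u)
      simpa using this
    obtain ⟨b, hb⟩ : ∃ b : W ≃ₗ[F] W, ∀ w, b w = (g (0, w)).2 := by
      refine ⟨LinearEquiv.ofInjectiveEndo (LinearMap.snd F U W ∘ₗ g.toLinearMap ∘ₗ
        LinearMap.inr F U W) ?_, fun u => rfl⟩
      rw [injective_iff_map_eq_zero]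
      intro w hw
      have : g (0, w) = 0 := Prod.ext (g1 w) hw
      simpa using this
    have hgab : ∀ x, g x = (a x.1, b x.2) := by
      rintro ⟨u, w⟩
      have : (u, w) = ((u, 0) : U × W) + (0, w) := by simp
      rw [this, map_add]
      ext
      · simp [g1, ha]
      · simp [g2, hb]
    have key : ∀ x, (B.prodMap C) (g x) = g ((B0.prodMap C0) x) := by
      intro x
      simpa using hgc X x
    refine ⟨(a, b), ?_⟩
    apply Subtype.ext
    refine Prod.ext ?_ (Prod.ext (Subtype.ext ?_) (Subtype.ext ?_))
    · apply LinearEquiv.ext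
      intro v
      have := hgab (e0 v)
      simp only [hg, LinearEquiv.trans_apply, LinearEquiv.symm_apply_apply] at this
      rw [this]
      rfl
    · ext u
      obtain ⟨u, rfl⟩ := a.surjective u
      have := key (u, 0)
      simp [hgab] at this
      simp [Φ, LinearEquiv.conjAlgEquiv_apply, this]
    · ext u
      obtain ⟨u, rfl⟩ := b.surjective u
      have := key (0, u)
      simp [hgab] at this
      simp [Φ, LinearEquiv.conjAlgEquiv_apply, this]

end LinearAlgebra

end

section

open Polynomial Finset

section Weighted

variable {F : Type*} [Field F] [Finite F]

/-- The proportion `annCard P n / |GL n|`. -/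
noncomputable def annRatio (P : F[X]) (n : ℕ) : ℝ := annCard P n / glOrd (Nat.card F) n

lemma sum_weight_ann {V : Type*} [AddCommGroup V] [Module F V] [FiniteDimensional F V] {n : ℕ}
    (hV : Module.finrank F V = n) {P Q : F[X]} (hPQ : IsCoprime P Q) (w : ℕ → ℝ) :
    (∑ᶠ A : {A : Module.End F V // aeval A (P * Q) = 0},
      w (Module.finrank F (LinearMap.ker (aeval A.1 P)))) =
      glOrd (Nat.card F) n *
        ∑ p ∈ antidiagonal n, w p.1 * annRatio P p.1 * annRatio Q p.2 := by
  classical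
  have := Fintype.ofFinite {A : Module.End F V // aeval A (P * Q) = 0}
  rw [finsum_eq_sum_of_fintype]
  let d : {A : Module.End F V // aeval A (P * Q) = 0} → ℕ × ℕ := fun A =>
    (Module.finrank F (LinearMap.ker (aeval A.1 P)),
      n - Module.finrank F (LinearMap.ker (aeval A.1 P)))
  have hd : ∀ A ∈ (Finset.univ : Finset {A : Module.End F V // aeval A (P * Q) = 0}),
      d A ∈ antidiagonal n := by
    intro A _
    have := Submodule.finrank_le (LinearMap.ker (aeval A.1 P))
    simp only [HasAntidiagonal.mem_antidiagonal, d]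
    omega
  rw [← Finset.sum_fiberwise_of_maps_to hd, Finset.mul_sum]
  refine Finset.sum_congr rfl ?_
  rintro ⟨i, j⟩ hij
  rw [HasAntidiagonal.mem_antidiagonal] at hij
  have h1 : ∀ A ∈ Finset.univ.filter (fun A => d A = (i, j)),
      w (Module.finrank F (LinearMap.ker (aeval A.1 P))) = w i := by
    intro A hA
    rw [Finset.mem_filter] at hA
    exact congrArg (fun p => w p.1) hA.2
  rw [Finset.sum_congr rfl h1, Finset.sum_const, nsmul_eq_mul]
  have h2 : (Finset.univ.filter (fun A => d A = (i, j))).card =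
      Nat.card {A : Module.End F V // aeval A (P * Q) = 0 ∧
        Module.finrank F (LinearMap.ker (aeval A P)) = i} := by
    rw [← Nat.card_congr (Equiv.subtypeSubtypeEquivSubtypeInter _ _), Nat.card_eq_fintype_card,
      Fintype.card_subtype]
    congr 1
    ext A
    simp only [Finset.mem_filter, Finset.mem_univ, true_and, d, Prod.mk.injEq]
    constructor
    · exact fun h => h.1
    · intro h
      exact ⟨h, by simp only at hij; omega⟩
  have h3 := annCard_mul_aux (F := F) (V := V) (U := Fin i → F) (W := Fin j → F) hPQ
    (by simp) (by simp) (hV.trans hij.symm)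
  rw [h2]
  have hq : 1 < Nat.card F := Finite.one_lt_card
  have g1 : (glOrd (Nat.card F) i : ℝ) ≠ 0 := by exact_mod_cast (glOrd_pos hq i).ne'
  have g2 : (glOrd (Nat.card F) j : ℝ) ≠ 0 := by exact_mod_cast (glOrd_pos hq j).ne'
  have h4 := congrArg (Nat.cast (R := ℝ)) h3
  push_cast at h4
  simp only at hij
  rw [hij] at h4
  unfold annRatio
  field_simp
  linear_combination (-w i) * h4

lemma annRatio_mul {P Q : F[X]} (hPQ : IsCoprime P Q) (n : ℕ) :
    annRatio (P * Q) n = ∑ p ∈ antidiagonal n, annRatio P p.1 * annRatio Q p.2 := by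
  have h := sum_weight_ann (F := F) (V := Fin n → F) (n := n) (by simp) hPQ (fun _ => 1)
  have hq : 1 < Nat.card F := Finite.one_lt_card
  have g1 : (glOrd (Nat.card F) n : ℝ) ≠ 0 := by exact_mod_cast (glOrd_pos hq n).ne'
  have := Fintype.ofFinite {A : Module.End F (Fin n → F) // aeval A (P * Q) = 0}
  rw [finsum_eq_sum_of_fintype] at h
  simp only [Finset.sum_const, Finset.card_univ, nsmul_eq_mul, mul_one, one_mul] at h
  rw [annRatio, annCard, Nat.card_eq_fintype_card, h]
  field_simp

omit [Finite F] in
lemma annRatio_one (n : ℕ) : annRatio (1 : F[X]) n = if n = 0 then 1 else 0 := by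
  rcases Nat.eq_zero_or_pos n with rfl | hn
  · have : Nat.card {A : Module.End F (Fin 0 → F) // aeval A (1 : F[X]) = 0} = 1 := by
      rw [Nat.card_eq_one_iff_unique]
      refine ⟨⟨fun a b => Subtype.ext (Subsingleton.elim _ _)⟩, ⟨0, Subsingleton.elim _ _⟩⟩
    rw [annRatio, annCard, this]
    simp [glOrd]
  · have : Nat.card {A : Module.End F (Fin n → F) // aeval A (1 : F[X]) = 0} = 0 := by
      rw [Nat.card_eq_zero]
      left
      refine ⟨fun ⟨A, hA⟩ => ?_⟩
      have : Nonempty (Fin n) := ⟨⟨0, hn⟩⟩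
      simp at hA
    rw [annRatio, annCard, this]
    simp [hn.ne']

end Weighted

section Irreducible

variable {F : Type*} [Field F]

/-- The module structure over `AdjoinRoot φ` on a space with an endomorphism killed by `φ`. -/
lemma exists_linearEquiv_adjoinRoot {V : Type*} [AddCommGroup V] [Module F V]
    [FiniteDimensional F V] (φ : F[X]) [Fact (Irreducible φ)] (A : Module.End F V)
    (hA : aeval A φ = 0) :
    ∃ m : ℕ, Module.finrank F V = m * φ.natDegree ∧ ∃ e : V ≃ₗ[F] (Fin m → AdjoinRoot φ),
      ∀ v, e (A v) = AdjoinRoot.root φ • e v := by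
  have hφ : φ ≠ 0 := (Fact.out : Irreducible φ).ne_zero
  let f : AdjoinRoot φ →ₐ[F] Module.End F V := 
    Ideal.Quotient.liftₐ (Ideal.span {φ}) (aeval A) fun p hp => by
      obtain ⟨r, rfl⟩ := Ideal.mem_span_singleton.1 hp
      rw [map_mul, hA, zero_mul]
  have hf : ∀ p, f (AdjoinRoot.mk φ p) = aeval A p := fun _ => rfl
  let : Module (AdjoinRoot φ) V := Module.compHom V f.toRingHom
  have hs : ∀ (k : AdjoinRoot φ) (v : V), k • v = f k v := fun _ _ => rfl
  have : IsScalarTower F (AdjoinRoot φ) V := ⟨fun a k v => by simp [hs]⟩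
  have : Module.Finite (AdjoinRoot φ) V := Module.Finite.of_restrictScalars_finite F _ _
  have hd : Module.finrank F (AdjoinRoot φ) = φ.natDegree := by
    rw [(AdjoinRoot.powerBasis hφ).finrank, AdjoinRoot.powerBasis_dim]
  have h := Module.finrank_mul_finrank F (AdjoinRoot φ) V
  refine ⟨Module.finrank (AdjoinRoot φ) V, by rw [← h, hd, mul_comm], ?_⟩
  let e : V ≃ₗ[AdjoinRoot φ] (Fin (Module.finrank (AdjoinRoot φ) V) → AdjoinRoot φ) :=
    LinearEquiv.ofFinrankEq _ _ (by simp)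
  refine ⟨e.restrictScalars F, fun v => ?_⟩
  have : A v = AdjoinRoot.root φ • v := by
    rw [hs, AdjoinRoot.root, hf, aeval_X]
  rw [this]
  exact e.map_smul _ _

variable [Finite F]

lemma annCard_irreducible (φ : F[X]) (hφ : Irreducible φ) (m : ℕ) :
    glOrd (Nat.card F) (m * φ.natDegree) =
      annCard φ (m * φ.natDegree) * glOrd (Nat.card F ^ φ.natDegree) m := by
  have : Fact (Irreducible φ) := ⟨hφ⟩
  have hd : Module.finrank F (AdjoinRoot φ) = φ.natDegree := by
    rw [(AdjoinRoot.powerBasis hφ.ne_zero).finrank, AdjoinRoot.powerBasis_dim]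
  have : Module.Finite F (AdjoinRoot φ) := (AdjoinRoot.powerBasis hφ.ne_zero).finite
  have : Finite (AdjoinRoot φ) := Module.finite_of_finite F
  have hK : Nat.card (AdjoinRoot φ) = Nat.card F ^ φ.natDegree := by
    rw [Module.natCard_eq_pow_finrank (K := F), hd]
  rw [← hK]
  set K := AdjoinRoot φ
  set n := m * φ.natDegree with hn
  have hW : Module.finrank F (Fin m → K) = n := by
    rw [← Module.finrank_mul_finrank F K, hd, Module.finrank_fin_fun, mul_comm]
  let L : K →ₐ[F] Module.End F (Fin m → K) := Algebra.lsmul F F (Fin m → K)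
  have hL : ∀ (k : K) x, L k x = k • x := fun _ _ => rfl
  have hLp : ∀ p : F[X], aeval (L (AdjoinRoot.root φ)) p = L (AdjoinRoot.mk φ p) := by
    intro p
    rw [aeval_algHom_apply, AdjoinRoot.aeval_eq]
  rw [← card_linearEquiv (F := F) (V := Fin n → F) (W := Fin m → K) (by simp) hW,
    ← card_linearEquiv (F := K) (V := Fin m → K) (W := Fin m → K) (by simp) (by simp)]
  let f : ((Fin n → F) ≃ₗ[F] (Fin m → K)) → {A : Module.End F (Fin n → F) // aeval A φ = 0} :=
    fun e => ⟨e.symm.conjAlgEquiv F (L (AdjoinRoot.root φ)), by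
      rw [aeval_conjAlgEquiv, hLp, AdjoinRoot.mk_self, map_zero, map_zero]⟩
  refine Nat.card_eq_mul_of_fiber f _ ?_
  rintro ⟨A, hA⟩
  obtain ⟨e0, he0⟩ : ∃ e : (Fin n → F) ≃ₗ[F] (Fin m → K),
      ∀ v, e (A v) = AdjoinRoot.root φ • e v := by
    obtain ⟨m', hm', e, he⟩ := exists_linearEquiv_adjoinRoot φ A hA
    rw [Module.finrank_fin_fun, hn] at hm'
    obtain rfl := Nat.eq_of_mul_eq_mul_right hφ.natDegree_pos hm'
    exact ⟨e, he⟩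
  have hfib : ∀ e, f e = ⟨A, hA⟩ ↔ ∀ v, e (A v) = AdjoinRoot.root φ • e v := by
    intro e
    rw [Subtype.ext_iff]
    constructor
    · intro h v
      have := congrArg (fun B => e (B v)) h
      simpa [f, LinearEquiv.conjAlgEquiv_apply, hL] using this.symm
    · intro h
      apply LinearMap.ext
      intro v
      change e.symm (AdjoinRoot.root φ • e v) = A v
      rw [← h, LinearEquiv.symm_apply_apply]
  let Φ : ((Fin m → K) ≃ₗ[K] (Fin m → K)) → {e // f e = ⟨A, hA⟩} := fun g =>
    ⟨e0 ≪≫ₗ g.restrictScalars F, by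
      rw [hfib]
      intro v
      simp [he0]⟩
  refine (Nat.card_congr (Equiv.ofBijective Φ ⟨?_, ?_⟩)).symm
  · intro g g' h
    apply LinearEquiv.ext
    intro x
    have := congrArg (fun e => e.1 (e0.symm x)) h
    simpa [Φ] using this
  · rintro ⟨e, he⟩
    rw [hfib] at he
    set g := e0.symm ≪≫ₗ e with hg
    have hroot : ∀ x, g (L (AdjoinRoot.root φ) x) = L (AdjoinRoot.root φ) (g x) := by
      intro x
      simp only [hL, hg, LinearEquiv.trans_apply]
      rw [← he]
      congr 1
      rw [LinearEquiv.symm_apply_eq, he0, LinearEquiv.apply_symm_apply]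
    have hsm : ∀ (k : K) x, g (k • x) = k • g x := by
      intro k x
      obtain ⟨p, rfl⟩ := AdjoinRoot.mk_surjective k
      rw [← hL, ← hL, ← hLp]
      induction p using Polynomial.induction_on' with
      | add p q hp hq => simp only [map_add, LinearMap.add_apply, hp, hq]
      | monomial n a =>
        rw [aeval_monomial, Module.End.mul_apply, Module.End.mul_apply,
          Module.algebraMap_end_apply, Module.algebraMap_end_apply, map_smul]
        congr 1
        induction n generalizing x with
        | zero => simp
        | succ n ih => rw [pow_succ, Module.End.mul_apply, ih, hroot, Module.End.mul_apply]
    refine ⟨{ g with map_smul' := hsm }, ?_⟩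
    apply Subtype.ext
    apply LinearEquiv.ext
    intro v
    change g (e0 v) = e v
    simp [hg]

lemma annRatio_irreducible (φ : F[X]) (hφ : Irreducible φ) (m : ℕ) :
    annRatio φ (m * φ.natDegree) = (glOrd (Nat.card F ^ φ.natDegree) m : ℝ)⁻¹ := by
  have hq : 1 < Nat.card F := Finite.one_lt_card
  have h := annCard_irreducible φ hφ m
  have h1 := (glOrd_pos hq (m * φ.natDegree)).ne'
  rw [annRatio]
  rw [h] at h1 ⊢
  have h2 : (annCard φ (m * φ.natDegree) : ℝ) ≠ 0 := by exact_mod_cast left_ne_zero_of_mul h1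
  push_cast
  rw [div_mul_cancel_left₀ h2]

omit [Finite F] in
lemma annRatio_irreducible_of_not_dvd (φ : F[X]) (hφ : Irreducible φ) {n : ℕ}
    (hn : ¬ φ.natDegree ∣ n) : annRatio φ n = 0 := by
  have : Fact (Irreducible φ) := ⟨hφ⟩
  have : annCard φ n = 0 := by
    rw [annCard, Nat.card_eq_zero]
    left
    refine ⟨fun ⟨A, hA⟩ => hn ?_⟩
    obtain ⟨m, hm, -⟩ := exists_linearEquiv_adjoinRoot φ A hA
    rw [Module.finrank_fin_fun] at hm
    exact ⟨m, by rw [hm, mul_comm]⟩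
  simp [annRatio, this]

end Irreducible

end

section

open Polynomial Finset

section IrreduciblePolynomials

variable (F : Type*) [Field F] [Finite F]

lemma finite_natDegree_le (N : ℕ) : {φ : F[X] | φ.natDegree ≤ N}.Finite := by
  have : Finite (degreeLT F (N + 1)) := Finite.of_equiv _ (degreeLTEquiv F (N + 1)).symm.toEquiv
  refine (Set.toFinite (degreeLT F (N + 1) : Set F[X])).subset fun φ hφ => ?_
  rw [SetLike.mem_coe, mem_degreeLT]
  exact lt_of_le_of_lt degree_le_natDegree (by exact_mod_cast Nat.lt_succ_of_le hφ)

/-- The finite set of monic irreducible polynomials of degree at most `N`. -/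
noncomputable def irrLE (N : ℕ) : Finset F[X] :=
  ((finite_natDegree_le F N).subset
    (fun _ h => h.2.2 : {φ : F[X] | φ.Monic ∧ Irreducible φ ∧ φ.natDegree ≤ N} ⊆ _)).toFinset

variable {F}

lemma mem_irrLE {N : ℕ} {φ : F[X]} :
    φ ∈ irrLE F N ↔ φ.Monic ∧ Irreducible φ ∧ φ.natDegree ≤ N := by
  simp [irrLE]

omit [Finite F] in
lemma isCoprime_of_monic_irreducible {φ ψ : F[X]} (h1 : φ.Monic) (h2 : Irreducible φ)
    (h3 : ψ.Monic) (h4 : Irreducible ψ) (h : φ ≠ ψ) : IsCoprime φ ψ := by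
  rw [h2.coprime_iff_not_dvd]
  intro hd
  exact h (eq_of_monic_of_associated h1 h3 (h2.associated_of_dvd h4 hd))

omit [Finite F] in
lemma isCoprime_prod_of_monic_irreducible {φ : F[X]} {S : Finset F[X]} (h1 : φ.Monic)
    (h2 : Irreducible φ) (hS : ∀ ψ ∈ S, ψ.Monic ∧ Irreducible ψ) (h : φ ∉ S) :
    IsCoprime φ (∏ ψ ∈ S, ψ) :=
  IsCoprime.prod_right fun ψ hψ => isCoprime_of_monic_irreducible h1 h2 (hS ψ hψ).1 (hS ψ hψ).2
    fun h' => h (h' ▸ hψ)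

open Classical in
/-- The product of the monic irreducible polynomials of degree at most `N` other than `X`
and `X - 1`. -/
noncomputable def irrProd (F : Type*) [Field F] [Finite F] (N : ℕ) : F[X] :=
  ∏ φ ∈ irrLE F N \ {X, X - C 1}, φ

lemma isCoprime_X_sub_one_irrProd (N : ℕ) : IsCoprime (X - C 1) (irrProd F N) := by
  classical
  refine isCoprime_prod_of_monic_irreducible (monic_X_sub_C _) (irreducible_X_sub_C _) ?_ (by simp)
  intro ψ hψ
  rw [mem_sdiff, mem_irrLE] at hψ
  exact ⟨hψ.1.1, hψ.1.2.1⟩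

lemma X_sub_one_mul_irrProd {N : ℕ} (hN : 1 ≤ N) [DecidableEq F[X]] :
    (X - C 1) * irrProd F N = ∏ φ ∈ (irrLE F N).erase X, φ := by
  have h1 : (X - C 1 : F[X]) ∈ (irrLE F N).erase X := by
    rw [mem_erase, mem_irrLE]
    refine ⟨?_, monic_X_sub_C _, irreducible_X_sub_C _, by rwa [natDegree_X_sub_C]⟩
    rw [Ne, sub_eq_self]
    simp
  rw [← mul_prod_erase _ _ h1, irrProd]
  congr 1
  refine prod_congr ?_ fun _ _ => rfl
  ext φ
  simp only [mem_sdiff, mem_insert, mem_singleton, mem_erase]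
  tauto

lemma squarefree_minpoly_iff {V : Type*} [AddCommGroup V] [Module F V] [FiniteDimensional F V]
    {N : ℕ} (hN : Module.finrank F V ≤ N) (hN' : 1 ≤ N) (A : Module.End F V) :
    (IsUnit A ∧ Squarefree (minpoly F A)) ↔ aeval A ((X - C 1) * irrProd F N) = 0 := by
  classical
  rw [X_sub_one_mul_irrProd hN']
  have hS : ∀ ψ ∈ (irrLE F N).erase X, ψ.Monic ∧ Irreducible ψ := by
    intro ψ hψ
    rw [mem_erase, mem_irrLE] at hψ
    exact ⟨hψ.2.1, hψ.2.2.1⟩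
  have hA_int : IsIntegral F A := Algebra.IsIntegral.isIntegral A
  constructor
  · rintro ⟨hu, hsq⟩
    rw [← minpoly.dvd_iff]
    have h0 : minpoly F A ≠ 0 := minpoly.ne_zero hA_int
    have hnd := (UniqueFactorizationMonoid.squarefree_iff_nodup_normalizedFactors h0).1 hsq
    have hass := UniqueFactorizationMonoid.prod_normalizedFactors h0
    refine hass.symm.dvd.trans ?_
    have : (UniqueFactorizationMonoid.normalizedFactors (minpoly F A)).prod =
        ∏ φ ∈ (⟨_, hnd⟩ : Finset F[X]), φ := by
      rw [prod_eq_multiset_prod]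
      simp
    rw [this]
    refine prod_dvd_prod_of_subset _ _ _ ?_
    intro φ hφ
    have hφ' : φ ∈ UniqueFactorizationMonoid.normalizedFactors (minpoly F A) := hφ
    have hirr := UniqueFactorizationMonoid.irreducible_of_normalized_factor φ hφ'
    have hdvd := UniqueFactorizationMonoid.dvd_of_mem_normalizedFactors hφ'
    have hmon : φ.Monic := by
      have := UniqueFactorizationMonoid.normalize_normalized_factor φ hφ'
      rw [← this]
      exact monic_normalize hirr.ne_zero
    rw [mem_erase, mem_irrLE]
    refine ⟨?_, hmon, hirr, ?_⟩
    · rintro rfl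
      obtain ⟨r, hr⟩ := hdvd
      have h1 := minpoly.aeval F A
      rw [hr, map_mul, aeval_X] at h1
      have h2 : aeval A r = 0 := by
        have := congrArg (fun B => hu.unit⁻¹.1 * B) h1
        simpa [← mul_assoc] using this
      have h3 := minpoly.dvd F A h2
      rw [hr] at h3
      have hr0 : r ≠ 0 := by
        rintro rfl
        simp [hr] at h0
      have := natDegree_le_of_dvd h3 hr0
      rw [natDegree_X_mul hr0] at this
      omega
    · calc φ.natDegree ≤ (minpoly F A).natDegree := natDegree_le_of_dvd hdvd h0
        _ ≤ (LinearMap.charpoly A).natDegree :=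
          natDegree_le_of_dvd (LinearMap.minpoly_dvd_charpoly A) (LinearMap.charpoly_monic A).ne_zero
        _ ≤ N := by rwa [LinearMap.charpoly_natDegree]
  · intro h
    constructor
    · obtain ⟨a, b, hab⟩ := isCoprime_prod_of_monic_irreducible (monic_X (R := F)) irreducible_X hS
        (by simp)
      have h1 := congrArg (aeval A) hab
      simp only [map_add, map_mul, aeval_X, map_one, h, mul_zero, add_zero] at h1
      exact IsUnit.of_mul_eq_one_right _ h1
    · refine Squarefree.squarefree_of_dvd (minpoly.dvd F A h) ?_
      refine squarefree_prod_of_pairwise_isCoprime ?_ fun φ hφ => (hS φ hφ).2.squarefree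
      intro φ hφ ψ hψ hne
      exact (isCoprime_of_monic_irreducible (hS φ hφ).1 (hS φ hφ).2 (hS ψ hψ).1 (hS ψ hψ).2
        hne).isRelPrime

end IrreduciblePolynomials

section Burnside

variable {F : Type} [Field F] [Fintype F] {n : ℕ}

omit [Fintype F] in
lemma isAff_iff (x : GL (Fin (n + 1)) F) :
    IsAff x ↔ x.val *ᵥ Pi.single 0 1 = Pi.single 0 1 := by
  rw [mulVec_single_one, funext_iff]
  constructor
  · rintro ⟨h0, h1⟩ j
    by_cases hj : j = 0
    · simp [hj, h0]
    · simp [hj, h1]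
  · intro h
    refine ⟨by simpa using h 0, fun j hj => by simpa [hj] using h j⟩

omit [Fintype F] in
lemma exists_GL_mulVec_eq {v w : Fin (n + 1) → F} (hv : v ≠ 0) (hw : w ≠ 0) :
    ∃ g : GL (Fin (n + 1)) F, g.val *ᵥ v = w := by
  let f : Submodule.span F {v} ≃ₗ[F] Submodule.span F {w} :=
    (LinearEquiv.toSpanNonzeroSingleton F _ v hv).symm ≪≫ₗ
      LinearEquiv.toSpanNonzeroSingleton F _ w hw
  obtain ⟨g, hg⟩ := Submodule.exists_linearEquiv_restrict_eq f
  have h1 : g v = w := by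
    have := hg ⟨v, Submodule.mem_span_singleton_self v⟩
    rw [← this]
    have h2 : (⟨v, Submodule.mem_span_singleton_self v⟩ : Submodule.span F {v}) =
      LinearEquiv.toSpanNonzeroSingleton F _ v hv 1 := by ext1; simp
    simp only [f, LinearEquiv.trans_apply]
    rw [h2, LinearEquiv.symm_apply_apply]
    simp
  refine ⟨Matrix.GeneralLinearGroup.toLin.symm
    (LinearMap.GeneralLinearGroup.ofLinearEquiv g), ?_⟩
  rw [← h1, ← Matrix.toLin'_apply]
  have : Matrix.toLin' (Matrix.GeneralLinearGroup.toLin.symm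
    (LinearMap.GeneralLinearGroup.ofLinearEquiv g)).val = g.toLinearMap := by
    have := congrArg Units.val (Matrix.GeneralLinearGroup.toLin.apply_symm_apply
      (LinearMap.GeneralLinearGroup.ofLinearEquiv g))
    exact this
  rw [this]
  rfl

lemma card_nonzero_vec : Nat.card {v : Fin (n + 1) → F // v ≠ 0} =
    Fintype.card F ^ (n + 1) - 1 := by
  classical
  rw [Nat.card_eq_fintype_card, Fintype.card_subtype_compl]
  simp

lemma card_fixed_nonzero {V : Type*} [AddCommGroup V] [Module F V] [FiniteDimensional F V]
    (A : Module.End F V) : (Nat.card {v : {v : V // v ≠ 0} // A v.1 = v.1} : ℝ) =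
      (Fintype.card F : ℝ) ^ Module.finrank F (LinearMap.ker (aeval A (X - C 1 : F[X]))) - 1 := by
  classical
  have : Finite V := Module.finite_of_finite F
  have h1 : Nat.card {v : {v : V // v ≠ 0} // A v.1 = v.1} =
      Nat.card {v : LinearMap.ker (aeval A (X - C 1 : F[X])) // v ≠ 0} := by
    refine Nat.card_congr ⟨fun v => ⟨⟨v.1.1, ?_⟩, ?_⟩, fun v => ⟨⟨v.1.1, ?_⟩, ?_⟩,
      fun _ => rfl, fun _ => rfl⟩
    · simp [v.2]
    · intro h
      exact v.1.2 (congrArg Subtype.val h)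
    · intro h
      exact v.2 (Subtype.ext h)
    · have := v.1.2
      rw [LinearMap.mem_ker] at this
      simpa [sub_eq_zero] using this
  have := Fintype.ofFinite (LinearMap.ker (aeval A (X - C 1 : F[X])))
  rw [h1, Nat.card_eq_fintype_card, Fintype.card_subtype_compl, Fintype.card_subtype_eq,
    ← Nat.card_eq_fintype_card, Module.natCard_eq_pow_finrank (K := F), Nat.card_eq_fintype_card,
    Nat.cast_sub (Nat.one_le_pow _ _ Fintype.card_pos)]
  simp

lemma card_isAff_and (R : GL (Fin (n + 1)) F → Prop) (hR : ∀ g x, R x → R (g * x * g⁻¹)) :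
    Nat.card {p : GL (Fin (n + 1)) F × {v : Fin (n + 1) → F // v ≠ 0} //
      R p.1 ∧ p.1.val *ᵥ p.2.1 = p.2.1} =
      (Fintype.card F ^ (n + 1) - 1) * Nat.card {x : GL (Fin (n + 1)) F // IsAff x ∧ R x} := by
  rw [← card_nonzero_vec]
  refine Nat.card_eq_mul_of_fiber (fun p => p.1.2) _ ?_
  rintro ⟨v, hv⟩
  obtain ⟨g, hg⟩ := exists_GL_mulVec_eq (F := F) (n := n) hv
    (w := Pi.single 0 1) (by simp)
  have hg' : g⁻¹.val *ᵥ Pi.single 0 1 = v := by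
    rw [← hg, mulVec_mulVec, ← Units.val_mul, inv_mul_cancel, Units.val_one, one_mulVec]
  refine Nat.card_congr ⟨fun p => ⟨g * p.1.1.1 * g⁻¹, ?_, hR _ _ p.1.2.1⟩,
    fun x => ⟨⟨(g⁻¹ * x.1 * g, ⟨v, hv⟩), ?_, ?_⟩, rfl⟩, ?_, ?_⟩
  · obtain ⟨⟨⟨x, ⟨w, hw⟩⟩, h1, h2⟩, h3⟩ := p
    obtain rfl : w = v := congrArg Subtype.val h3
    simp only at h2
    rw [isAff_iff]
    simp only [Units.val_mul]
    rw [← mulVec_mulVec, ← mulVec_mulVec, hg', h2, hg]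
  · simpa using hR g⁻¹ _ x.2.2
  · simp only [Units.val_mul]
    rw [← mulVec_mulVec, ← mulVec_mulVec, hg, (isAff_iff _).1 x.2.1, hg']
  · rintro ⟨⟨⟨x, ⟨w, hw⟩⟩, h1, h2⟩, h3⟩
    obtain rfl : w = v := congrArg Subtype.val h3
    simp [mul_assoc]
  · rintro ⟨x, hx⟩
    simp [mul_assoc]

lemma card_isAff : glOrd (Nat.card F) (n + 1) =
    (Fintype.card F ^ (n + 1) - 1) * Nat.card {x : GL (Fin (n + 1)) F // IsAff x} := by
  rw [Nat.card_eq_fintype_card, glOrd, ← Matrix.card_GL_field, ← card_nonzero_vec]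
  have hne : ∀ g : GL (Fin (n + 1)) F, g.val *ᵥ Pi.single 0 1 ≠ 0 := by
    intro g h
    have := congrArg (fun v => g⁻¹.val *ᵥ v) h
    simp only [mulVec_mulVec, ← Units.val_mul, inv_mul_cancel, Units.val_one, one_mulVec,
      mulVec_zero] at this
    simp at this
  refine Nat.card_eq_mul_of_fiber (fun g => ⟨g.val *ᵥ Pi.single 0 1, hne g⟩) _ ?_
  · rintro ⟨v, hv⟩
    obtain ⟨g, hg⟩ := exists_GL_mulVec_eq (F := F) (n := n) (v := Pi.single 0 1) (by simp) hv
    have hg' : g⁻¹.val *ᵥ v = Pi.single 0 1 := by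
      rw [← hg, mulVec_mulVec, ← Units.val_mul, inv_mul_cancel, Units.val_one, one_mulVec]
    refine Nat.card_congr ((Equiv.mulLeft g⁻¹).subtypeEquiv fun x => ?_)
    rw [isAff_iff, Subtype.ext_iff]
    simp only [Equiv.coe_mulLeft, Units.val_mul]
    rw [← mulVec_mulVec]
    constructor
    · intro h
      rw [h, hg']
    · intro h
      have := congrArg (fun w => g.val *ᵥ w) h
      simpa only [mulVec_mulVec, ← Units.val_mul, mul_inv_cancel, Units.val_one, one_mulVec, hg,
        ← mul_assoc, one_mul, mul_inv_cancel_left] using this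

omit [Fintype F] in
lemma minpoly_conj_GL (g x : GL (Fin (n + 1)) F) :
    minpoly F (g * x * g⁻¹).val = minpoly F x.val := by
  let e : Matrix (Fin (n + 1)) (Fin (n + 1)) F ≃ₐ[F] Matrix (Fin (n + 1)) (Fin (n + 1)) F :=
    AlgEquiv.ofAlgHom
      { toFun := fun y => g.val * y * g⁻¹.val
        map_one' := by simp [-coe_units_inv]
        map_mul' := fun a b => by simp [mul_assoc, -coe_units_inv]
        map_zero' := by simp
        map_add' := fun a b => by simp [mul_add, add_mul]
        commutes' := fun a => by
          rw [← Algebra.commutes, mul_assoc, ← Units.val_mul, mul_inv_cancel]; simp }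
      { toFun := fun y => g⁻¹.val * y * g.val
        map_one' := by simp [-coe_units_inv]
        map_mul' := fun a b => by simp [mul_assoc, -coe_units_inv]
        map_zero' := by simp
        map_add' := fun a b => by simp [mul_add, add_mul]
        commutes' := fun a => by
          rw [← Algebra.commutes, mul_assoc, ← Units.val_mul, inv_mul_cancel]; simp }
      (by ext1 y; simp [mul_assoc, -coe_units_inv]) (by ext1 y; simp [mul_assoc, -coe_units_inv])
  exact minpoly.algEquiv_eq e x.val

lemma ssA_eq_sum {N : ℕ} (hN : n + 1 ≤ N) :
    ssA F n = ∑ p ∈ antidiagonal (n + 1), ((Fintype.card F : ℝ) ^ p.1 - 1) *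
      annRatio (X - C 1 : F[X]) p.1 * annRatio (irrProd F N) p.2 := by
  classical
  have hq : 1 < Nat.card F := Finite.one_lt_card
  have hq' : 1 < Fintype.card F := Fintype.one_lt_card
  have h1 := sum_weight_ann (F := F) (V := Fin (n + 1) → F) (n := n + 1) (by simp)
    (isCoprime_X_sub_one_irrProd N) (fun i => (Fintype.card F : ℝ) ^ i - 1)
  have h2 := card_isAff_and (F := F) (n := n) (fun x => Squarefree (minpoly F x.val)) (by
    intro g x hx
    rwa [minpoly_conj_GL])
  have h3 := card_isAff (F := F) (n := n)
  have hunit : ∀ M : Matrix (Fin (n + 1)) (Fin (n + 1)) F,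
      (IsUnit M ∧ Squarefree (minpoly F M)) ↔
        aeval (Matrix.toLin' M) ((X - C 1) * irrProd F N) = 0 := by
    intro M
    rw [← squarefree_minpoly_iff (by simpa using hN) (by omega), Matrix.minpoly_toLin']
    have : IsUnit (Matrix.toLin' M) ↔ IsUnit M :=
      MulEquiv.isUnit_map (Matrix.toLinAlgEquiv' (R := F) (n := Fin (n + 1)))
    rw [this]
  let e : {x : GL (Fin (n + 1)) F // Squarefree (minpoly F x.val)} ≃
      {A : Module.End F (Fin (n + 1) → F) // aeval A ((X - C 1) * irrProd F N) = 0} :=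
    Equiv.ofBijective (fun x => ⟨Matrix.toLin' x.1.val, (hunit _).1 ⟨x.1.isUnit, x.2⟩⟩) (by
      constructor
      · intro x y h
        have := congrArg Subtype.val h
        exact Subtype.ext (Units.ext (Matrix.toLin'.injective this))
      · rintro ⟨A, hA⟩
        obtain ⟨M, rfl⟩ := Matrix.toLin'.surjective A
        obtain ⟨hu, hs⟩ := (hunit M).2 hA
        exact ⟨⟨hu.unit, hs⟩, rfl⟩)
  have h4 : (Nat.card {p : GL (Fin (n + 1)) F × {v : Fin (n + 1) → F // v ≠ 0} //
      Squarefree (minpoly F p.1.val) ∧ p.1.val *ᵥ p.2.1 = p.2.1} : ℝ) =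
      ∑ᶠ A : {A : Module.End F (Fin (n + 1) → F) // aeval A ((X - C 1) * irrProd F N) = 0},
        ((Fintype.card F : ℝ) ^
          (Module.finrank F (LinearMap.ker (aeval A.1 (X - C 1 : F[X])))) - 1) := by
    have e' : {p : GL (Fin (n + 1)) F × {v : Fin (n + 1) → F // v ≠ 0} //
      Squarefree (minpoly F p.1.val) ∧ p.1.val *ᵥ p.2.1 = p.2.1} ≃
      Σ x : {x : GL (Fin (n + 1)) F // Squarefree (minpoly F x.val)},
        {v : {v : Fin (n + 1) → F // v ≠ 0} // Matrix.toLin' x.1.val v.1 = v.1} :=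
      ⟨fun p => ⟨⟨p.1.1, p.2.1⟩, ⟨p.1.2, by simpa using p.2.2⟩⟩,
        fun s => ⟨(s.1.1, s.2.1), s.1.2, by simpa using s.2.2⟩, fun _ => rfl, fun _ => rfl⟩
    have := Fintype.ofFinite {x : GL (Fin (n + 1)) F // Squarefree (minpoly F x.val)}
    rw [Nat.card_congr e', Nat.card_sigma, ← finsum_comp_equiv e, finsum_eq_sum_of_fintype]
    push_cast
    exact sum_congr rfl fun x _ => card_fixed_nonzero _
  rw [← h4, h2] at h1
  have h5 : (Fintype.card F ^ (n + 1) - 1 : ℕ) ≠ 0 := by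
    have : 1 < Fintype.card F ^ (n + 1) := Nat.one_lt_pow (Nat.succ_ne_zero n) hq'
    omega
  have h6 := (glOrd_pos hq (n + 1)).ne'
  have h7 : Nat.card {x : GL (Fin (n + 1)) F // IsAff x} ≠ 0 := by
    intro h
    rw [h3, h] at h6
    simp at h6
  rw [h3] at h1
  rw [ssA, div_eq_iff (by exact_mod_cast h7)]
  push_cast [-Nat.cast_sub] at h1
  refine mul_left_cancel₀ (a := ((Fintype.card F ^ (n + 1) - 1 : ℕ) : ℝ)) (by exact_mod_cast h5) ?_
  rw [h1]
  ring

end Burnside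

end

section PowerSeriesNorm

open PowerSeries Finset

/-- Absolute convergence of a power series at the nonnegative real `t`. -/
def SummableAt (t : ℝ) (p : ℝ⟦X⟧) : Prop := Summable fun n => |coeff n p| * t ^ n

/-- The majorant norm of a power series at the nonnegative real `t`. -/
noncomputable def majorant (t : ℝ) (p : ℝ⟦X⟧) : ℝ := ∑' n, |coeff n p| * t ^ n

/-- The value of a power series at `t`. -/
noncomputable def evalAt (t : ℝ) (p : ℝ⟦X⟧) : ℝ := ∑' n, coeff n p * t ^ n

variable {t : ℝ} {p p' : ℝ⟦X⟧}

lemma summableAt_iff (ht : 0 ≤ t) :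
    SummableAt t p ↔ Summable fun n => ‖coeff n p * t ^ n‖ := by
  simp only [SummableAt, norm_mul, Real.norm_eq_abs, abs_of_nonneg (pow_nonneg ht _)]

lemma coeff_mul_mul_pow (n : ℕ) : coeff n (p * p') * t ^ n =
    ∑ k ∈ antidiagonal n, (coeff k.1 p * t ^ k.1) * (coeff k.2 p' * t ^ k.2) := by
  rw [coeff_mul, sum_mul]
  refine sum_congr rfl fun k hk => ?_
  rw [← HasAntidiagonal.mem_antidiagonal.1 hk, pow_add]
  ring

lemma SummableAt.mul (ht : 0 ≤ t) (h : SummableAt t p) (h' : SummableAt t p') :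
    SummableAt t (p * p') := by
  rw [summableAt_iff ht] at h h' ⊢
  have h3 := summable_norm_sum_mul_antidiagonal_of_summable_norm h h'
  simp only [coeff_mul_mul_pow]
  exact h3

lemma evalAt_mul (ht : 0 ≤ t) (h : SummableAt t p) (h' : SummableAt t p') :
    evalAt t (p * p') = evalAt t p * evalAt t p' := by
  rw [summableAt_iff ht] at *
  simp only [evalAt, coeff_mul_mul_pow]
  exact (tsum_mul_tsum_eq_tsum_sum_antidiagonal_of_summable_norm h h').symm

lemma majorant_nonneg (ht : 0 ≤ t) : 0 ≤ majorant t p :=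
  tsum_nonneg fun _ => mul_nonneg (abs_nonneg _) (pow_nonneg ht _)

lemma majorant_mul_le (ht : 0 ≤ t) (h : SummableAt t p) (h' : SummableAt t p') :
    majorant t (p * p') ≤ majorant t p * majorant t p' := by
  have h3 := SummableAt.mul ht h h'
  unfold SummableAt at h h'
  have hn : Summable fun n => ‖|coeff n p| * t ^ n‖ := h.norm
  have hn' : Summable fun n => ‖|coeff n p'| * t ^ n‖ := h'.norm
  rw [majorant, majorant, majorant,
    tsum_mul_tsum_eq_tsum_sum_antidiagonal_of_summable_norm hn hn']
  refine Summable.tsum_le_tsum (fun n => ?_) h3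
    (summable_norm_sum_mul_antidiagonal_of_summable_norm hn hn').of_norm
  rw [coeff_mul]
  refine (mul_le_mul_of_nonneg_right (abs_sum_le_sum_abs _ _) (pow_nonneg ht n)).trans ?_
  rw [sum_mul]
  refine le_of_eq (sum_congr rfl fun k hk => ?_)
  rw [← HasAntidiagonal.mem_antidiagonal.1 hk, pow_add, abs_mul]
  ring

lemma SummableAt.one : SummableAt t 1 := by
  refine summable_of_ne_finset_zero (s := {0}) fun n hn => ?_
  rw [mem_singleton] at hn
  simp [coeff_one, hn]

lemma evalAt_one : evalAt t 1 = 1 := by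
  rw [evalAt, tsum_eq_single 0 fun n hn => by simp [coeff_one, hn]]
  simp

lemma majorant_one : majorant t 1 = 1 := by
  rw [majorant, tsum_eq_single 0 fun n hn => by simp [coeff_one, hn]]
  simp

lemma SummableAt.prod {ι : Type*} (ht : 0 ≤ t) (s : Finset ι) (f : ι → ℝ⟦X⟧)
    (h : ∀ i ∈ s, SummableAt t (f i)) : SummableAt t (∏ i ∈ s, f i) :=
  Finset.prod_induction f (SummableAt t) (fun _ _ => SummableAt.mul ht) SummableAt.one h

lemma evalAt_prod {ι : Type*} (ht : 0 ≤ t) (s : Finset ι) (f : ι → ℝ⟦X⟧)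
    (h : ∀ i ∈ s, SummableAt t (f i)) : evalAt t (∏ i ∈ s, f i) = ∏ i ∈ s, evalAt t (f i) := by
  classical
  induction s using Finset.induction_on with
  | empty => simp [evalAt_one]
  | insert a s ha ih =>
    have h' : ∀ i ∈ s, SummableAt t (f i) := fun i hi => h i (mem_insert_of_mem hi)
    rw [prod_insert ha, prod_insert ha,
      evalAt_mul ht (h a (mem_insert_self _ _)) (SummableAt.prod ht s f h'), ih h']

lemma majorant_prod_le {ι : Type*} (ht : 0 ≤ t) (s : Finset ι) (f : ι → ℝ⟦X⟧)
    (h : ∀ i ∈ s, SummableAt t (f i)) :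
    majorant t (∏ i ∈ s, f i) ≤ ∏ i ∈ s, majorant t (f i) := by
  classical
  induction s using Finset.induction_on with
  | empty => simp [majorant_one]
  | insert a s ha ih =>
    have h' : ∀ i ∈ s, SummableAt t (f i) := fun i hi => h i (mem_insert_of_mem hi)
    rw [prod_insert ha, prod_insert ha]
    exact (majorant_mul_le ht (h a (mem_insert_self _ _)) (SummableAt.prod ht s f h')).trans
      (mul_le_mul_of_nonneg_left (ih h') (majorant_nonneg ht))

lemma SummableAt.mono {t' : ℝ} (ht' : 0 ≤ t') (htt : t' ≤ t) (h : SummableAt t p) :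
    SummableAt t' p :=
  Summable.of_nonneg_of_le (fun _ => mul_nonneg (abs_nonneg _) (pow_nonneg ht' _))
    (fun _ => mul_le_mul_of_nonneg_left (pow_le_pow_left₀ ht' htt _) (abs_nonneg _)) h

lemma SummableAt.abs_coeff_mul_le (ht : 0 ≤ t) (h : SummableAt t p) (n : ℕ) :
    |coeff n p| * t ^ n ≤ majorant t p :=
  h.le_tsum n fun _ _ => mul_nonneg (abs_nonneg _) (pow_nonneg ht _)

lemma summableAt_one_sub_C_mul_X_pow (a : ℝ) (d : ℕ) :
    SummableAt t (1 - C a * X ^ d : ℝ⟦X⟧) := by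
  refine summable_of_ne_finset_zero (s := {0, d}) fun n hn => ?_
  rw [mem_insert, mem_singleton, not_or] at hn
  simp [coeff_one, coeff_X_pow, hn]

lemma evalAt_one_sub_C_mul_X_pow (a : ℝ) {d : ℕ} (hd : d ≠ 0) :
    evalAt t (1 - C a * X ^ d : ℝ⟦X⟧) = 1 - a * t ^ d := by
  rw [evalAt, tsum_eq_sum (s := {0, d}) fun n hn => by
    rw [mem_insert, mem_singleton, not_or] at hn
    simp [coeff_one, coeff_X_pow, hn]]
  rw [sum_pair hd.symm]
  simp [coeff_one, coeff_X_pow, hd]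
  ring

end PowerSeriesNorm

section Zeta

open Polynomial Finset

variable {F : Type*} [Field F]

/-- The monic polynomials of degree `n` all of whose monic irreducible factors lie in `S`. -/
def smoothSet (S : Finset F[X]) (n : ℕ) : Set F[X] :=
  {f | f.Monic ∧ f.natDegree = n ∧ ∀ p : F[X], p.Monic → Irreducible p → p ∣ f → p ∈ S}

lemma ncard_monic_natDegree_eq [Finite F] (n : ℕ) :
    {f : F[X] | f.Monic ∧ f.natDegree = n}.ncard = Nat.card F ^ n := by
  rw [← Nat.card_coe_set_eq]
  refine (Nat.card_congr ((monicEquivDegreeLT n).trans (degreeLTEquiv F n).toEquiv)).trans ?_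
  simp [Nat.card_fun]

lemma smoothSet_subset (S : Finset F[X]) (n : ℕ) :
    smoothSet S n ⊆ {f : F[X] | f.Monic ∧ f.natDegree = n} := fun _ h => ⟨h.1, h.2.1⟩

lemma finite_monic_natDegree_eq [Finite F] (n : ℕ) :
    {f : F[X] | f.Monic ∧ f.natDegree = n}.Finite :=
  (finite_natDegree_le F n).subset fun _ h => h.2.le

lemma ncard_smoothSet_le [Finite F] (S : Finset F[X]) (n : ℕ) :
    (smoothSet S n).ncard ≤ Nat.card F ^ n := by
  rw [← ncard_monic_natDegree_eq]
  exact Set.ncard_le_ncard (smoothSet_subset S n) (finite_monic_natDegree_eq n)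

lemma ncard_smoothSet_irrLE [Finite F] {N n : ℕ} (hn : n ≤ N) :
    (smoothSet (irrLE F N) n).ncard = Nat.card F ^ n := by
  rw [← ncard_monic_natDegree_eq]
  congr 1
  refine (smoothSet_subset _ n).antisymm fun f hf => ⟨hf.1, hf.2, fun p hp hi hd => ?_⟩
  rw [mem_irrLE]
  exact ⟨hp, hi, (natDegree_le_of_dvd hd hf.1.ne_zero).trans (hf.2.le.trans hn)⟩

lemma ncard_smoothSet_empty (n : ℕ) :
    (smoothSet (∅ : Finset F[X]) n).ncard = if n = 0 then 1 else 0 := by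
  have h : ∀ f ∈ smoothSet (∅ : Finset F[X]) n, f = 1 := by
    intro f hf
    by_contra h1
    have hu : ¬ IsUnit f := fun hu => h1 (hf.1.eq_one_of_isUnit hu)
    obtain ⟨p, hp, hi, hd⟩ := exists_monic_irreducible_factor f hu
    simpa using hf.2.2 p hp hi hd
  split_ifs with hn
  · subst hn
    rw [Set.ncard_eq_one]
    refine ⟨1, Set.eq_singleton_iff_unique_mem.2 ⟨⟨monic_one, by simp, ?_⟩, h⟩⟩
    intro p _ hi hd
    exact absurd (isUnit_of_dvd_one hd) hi.not_isUnit
  · rw [Set.ncard_eq_zero (Set.Finite.subset (Set.finite_singleton 1) h),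
      Set.eq_empty_iff_forall_notMem]
    intro f hf
    have := h f hf
    subst this
    exact hn (by simpa using hf.2.1.symm)

lemma ncard_smoothSet_insert [Finite F] [DecidableEq F[X]] {S : Finset F[X]} {φ : F[X]}
    (hφ : φ.Monic) (hi : Irreducible φ) (hS : φ ∉ S) (n : ℕ) :
    (smoothSet (insert φ S) n).ncard = (smoothSet S n).ncard +
      if φ.natDegree ≤ n then (smoothSet (insert φ S) (n - φ.natDegree)).ncard else 0 := by
  have hfin : ∀ (T : Finset F[X]) k, (smoothSet T k).Finite := fun T k =>
    (finite_monic_natDegree_eq k).subset (smoothSet_subset T k)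
  have h1 : smoothSet S n = {f ∈ smoothSet (insert φ S) n | ¬ φ ∣ f} := by
    ext f
    constructor
    · rintro ⟨h1, h2, h3⟩
      exact ⟨⟨h1, h2, fun p hp hi hd => mem_insert_of_mem (h3 p hp hi hd)⟩,
        fun hd => hS (h3 φ hφ hi hd)⟩
    · rintro ⟨⟨h1, h2, h3⟩, h4⟩
      refine ⟨h1, h2, fun p hp hi hd => ?_⟩
      rcases mem_insert.1 (h3 p hp hi hd) with rfl | h
      · exact absurd hd h4
      · exact h
  have h2 : (if φ.natDegree ≤ n then (smoothSet (insert φ S) (n - φ.natDegree)).ncard else 0) =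
      {f ∈ smoothSet (insert φ S) n | φ ∣ f}.ncard := by
    split_ifs with hd
    · rw [← Set.ncard_image_of_injective _ (mul_right_injective₀ hφ.ne_zero)]
      congr 1
      ext f
      constructor
      · rintro ⟨g, ⟨h1, h2, h3⟩, rfl⟩
        refine ⟨⟨hφ.mul h1, ?_, fun p hp hpi hpd => ?_⟩, dvd_mul_right _ _⟩
        · rw [hφ.natDegree_mul h1, h2]
          omega
        · rcases (hpi.prime.dvd_mul).1 hpd with h | h
          · rw [eq_of_monic_of_associated hp hφ (hpi.associated_of_dvd hi h)]
            exact mem_insert_self _ _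
          · exact h3 p hp hpi h
      · rintro ⟨⟨h1, h2, h3⟩, g, rfl⟩
        have hg : g.Monic := hφ.of_mul_monic_left h1
        refine ⟨g, ⟨hg, ?_, fun p hp hpi hpd => h3 p hp hpi (hpd.mul_left _)⟩, rfl⟩
        rw [hφ.natDegree_mul hg] at h2
        omega
    · symm
      rw [Set.ncard_eq_zero ((hfin _ _).subset (Set.sep_subset _ _)),
        Set.eq_empty_iff_forall_notMem]
      rintro f ⟨⟨h1, h2, -⟩, h3⟩
      exact hd (h2 ▸ natDegree_le_of_dvd h3 h1.ne_zero)
  have hdisj : Disjoint {f ∈ smoothSet (insert φ S) n | φ ∣ f}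
      {f ∈ smoothSet (insert φ S) n | ¬ φ ∣ f} := by
    rw [Set.disjoint_left]
    rintro f ⟨_, h⟩ ⟨_, h'⟩
    exact h' h
  rw [h2, h1, add_comm, ← Set.ncard_union_eq hdisj ((hfin _ _).subset (Set.sep_subset _ _))
    ((hfin _ _).subset (Set.sep_subset _ _))]
  congr 1
  ext f
  simp only [Set.mem_union, Set.mem_ofPred_eq]
  tauto

/-- The Euler factor `1 - (u / q) ^ d`. -/
noncomputable def eulerFactor (q d : ℕ) : PowerSeries ℝ :=
  1 - PowerSeries.C ((q : ℝ)⁻¹ ^ d) * PowerSeries.X ^ d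

/-- The normalised generating function of the monic polynomials with all factors in `S`. -/
noncomputable def smoothSeries (S : Finset F[X]) : PowerSeries ℝ :=
  PowerSeries.mk fun n => (smoothSet S n).ncard * (Nat.card F : ℝ)⁻¹ ^ n

lemma prod_eulerFactor_mul_smoothSeries [Finite F] (S : Finset F[X])
    (hS : ∀ φ ∈ S, φ.Monic ∧ Irreducible φ) :
    (∏ φ ∈ S, eulerFactor (Nat.card F) φ.natDegree) * smoothSeries S = 1 := by
  classical
  induction S using Finset.induction_on with
  | empty =>
    ext n
    simp only [prod_empty, one_mul, smoothSeries, PowerSeries.coeff_mk, ncard_smoothSet_empty,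
      PowerSeries.coeff_one]
    split_ifs with h <;> simp [h]
  | insert φ S hφ ih =>
    obtain ⟨hm, hi⟩ := hS φ (mem_insert_self _ _)
    have h1 : eulerFactor (Nat.card F) φ.natDegree * smoothSeries (insert φ S) =
        smoothSeries S := by
      ext n
      rw [eulerFactor, sub_mul, one_mul, map_sub, mul_assoc, PowerSeries.coeff_C_mul,
        PowerSeries.coeff_X_pow_mul']
      simp only [smoothSeries, PowerSeries.coeff_mk]
      rw [ncard_smoothSet_insert hm hi hφ n]
      split_ifs with h
      · have : (Nat.card F : ℝ)⁻¹ ^ n =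
            (Nat.card F : ℝ)⁻¹ ^ φ.natDegree * (Nat.card F : ℝ)⁻¹ ^ (n - φ.natDegree) := by
          rw [← pow_add]
          congr 1
          omega
        push_cast
        rw [this]
        ring
      · simp
    rw [prod_insert hφ, mul_comm (eulerFactor _ _), mul_assoc, h1]
    exact ih fun ψ hψ => hS ψ (mem_insert_of_mem hψ)

lemma coeff_smoothSeries_irrLE [Finite F] {N n : ℕ} (hn : n ≤ N) :
    PowerSeries.coeff n (smoothSeries (irrLE F N)) = 1 := by
  have h0 : (Nat.card F : ℝ) ≠ 0 := by exact_mod_cast (Nat.card_pos (α := F)).ne'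
  rw [smoothSeries, PowerSeries.coeff_mk, ncard_smoothSet_irrLE hn, Nat.cast_pow, ← mul_pow,
    mul_inv_cancel₀ h0, one_pow]

lemma coeff_smoothSeries_nonneg (S : Finset F[X]) (n : ℕ) :
    0 ≤ PowerSeries.coeff n (smoothSeries S) := by
  rw [smoothSeries, PowerSeries.coeff_mk]
  positivity

lemma coeff_smoothSeries_le_one [Finite F] (S : Finset F[X]) (n : ℕ) :
    PowerSeries.coeff n (smoothSeries S) ≤ 1 := by
  have h0 : 0 < (Nat.card F : ℝ) := by exact_mod_cast Nat.card_pos (α := F)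
  rw [smoothSeries, PowerSeries.coeff_mk, inv_pow, ← div_eq_mul_inv, div_le_one (by positivity)]
  exact_mod_cast ncard_smoothSet_le S n

/-- Multiplication by the truncated Euler product agrees with multiplication by `1 - u` up to
the order of truncation. -/
lemma coeff_mul_prod_eulerFactor [Finite F] (G : PowerSeries ℝ) {N k : ℕ} (hk : k ≤ N) :
    PowerSeries.coeff k (G * ∏ φ ∈ irrLE F N, eulerFactor (Nat.card F) φ.natDegree) =
      PowerSeries.coeff k (G * (1 - PowerSeries.X)) := by
  have h1 := prod_eulerFactor_mul_smoothSeries (irrLE F N)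
    fun φ hφ => ⟨(mem_irrLE.1 hφ).1, (mem_irrLE.1 hφ).2.1⟩
  set E := ∏ φ ∈ irrLE F N, eulerFactor (Nat.card F) φ.natDegree
  have h2 : (PowerSeries.X : PowerSeries ℝ) ^ (N + 1) ∣
      1 - (1 - PowerSeries.X) * smoothSeries (irrLE F N) := by
    rw [PowerSeries.X_pow_dvd_iff]
    intro m hm
    rw [sub_mul, one_mul, map_sub, map_sub]
    rcases m with _ | m
    · simp only [PowerSeries.coeff_zero_one, coeff_smoothSeries_irrLE (Nat.zero_le N),
        PowerSeries.coeff_zero_X_mul]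
      norm_num
    · rw [PowerSeries.coeff_succ_X_mul, coeff_smoothSeries_irrLE (by omega),
        coeff_smoothSeries_irrLE (by omega), PowerSeries.coeff_one]
      simp
  have h3 : (PowerSeries.X : PowerSeries ℝ) ^ (N + 1) ∣ G * E - G * (1 - PowerSeries.X) := by
    obtain ⟨R, hR⟩ := h2
    refine ⟨G * E * R, ?_⟩
    have h4 : G * (1 - PowerSeries.X) =
        G * (1 - PowerSeries.X) * (E * smoothSeries (irrLE F N)) := by rw [h1, mul_one]
    rw [h4]
    linear_combination G * E * hR
  rw [← sub_eq_zero, ← map_sub]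
  exact PowerSeries.X_pow_dvd_iff.1 h3 k (by omega)

section Evaluate

variable [Finite F] {t : ℝ}

lemma summableAt_smoothSeries (ht : 0 ≤ t) (ht1 : t < 1) (S : Finset F[X]) :
    SummableAt t (smoothSeries S) := by
  refine Summable.of_nonneg_of_le (fun n => by positivity) (fun n => ?_)
    (summable_geometric_of_lt_one ht ht1)
  rw [abs_of_nonneg (coeff_smoothSeries_nonneg S n)]
  exact mul_le_of_le_one_left (pow_nonneg ht _) (coeff_smoothSeries_le_one S n)

lemma summableAt_eulerFactor (t : ℝ) (q d : ℕ) : SummableAt t (eulerFactor q d) :=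
  summableAt_one_sub_C_mul_X_pow _ _

lemma prod_one_sub_mul_evalAt (ht : 0 ≤ t) (ht1 : t < 1) (S : Finset F[X])
    (hS : ∀ φ ∈ S, φ.Monic ∧ Irreducible φ) :
    (∏ φ ∈ S, (1 - ((Nat.card F : ℝ)⁻¹ * t) ^ φ.natDegree)) * evalAt t (smoothSeries S) = 1 := by
  have h := congrArg (evalAt t) (prod_eulerFactor_mul_smoothSeries S hS)
  rw [evalAt_one, evalAt_mul ht (SummableAt.prod ht _ _ fun φ _ =>
    summableAt_eulerFactor _ _ _) (summableAt_smoothSeries ht ht1 S),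
    evalAt_prod ht _ _ (fun φ _ => summableAt_eulerFactor _ _ _)] at h
  refine Eq.trans (congrArg (· * _) ?_) h
  refine prod_congr rfl fun φ hφ => ?_
  rw [eulerFactor, evalAt_one_sub_C_mul_X_pow _ (hS φ hφ).2.natDegree_pos.ne', mul_pow]

lemma one_sub_le_prod_irrLE (ht : 0 ≤ t) (ht1 : t < 1) (N : ℕ) :
    1 - t ≤ ∏ φ ∈ irrLE F N, (1 - ((Nat.card F : ℝ)⁻¹ * t) ^ φ.natDegree) := by
  have h := prod_one_sub_mul_evalAt ht ht1 (irrLE F N)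
    fun φ hφ => ⟨(mem_irrLE.1 hφ).1, (mem_irrLE.1 hφ).2.1⟩
  have h1 : evalAt t (smoothSeries (irrLE F N)) ≤ (1 - t)⁻¹ := by
    rw [← tsum_geometric_of_lt_one ht ht1]
    refine Summable.tsum_le_tsum (fun n => ?_)
      ((summableAt_iff ht).1 (summableAt_smoothSeries ht ht1 _)).of_norm
      (summable_geometric_of_lt_one ht ht1)
    exact mul_le_of_le_one_left (pow_nonneg ht _) (coeff_smoothSeries_le_one _ n)
  have h0 : 0 ≤ evalAt t (smoothSeries (irrLE F N)) :=
    tsum_nonneg fun n => mul_nonneg (coeff_smoothSeries_nonneg _ _) (pow_nonneg ht _)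
  have h2 : 0 < evalAt t (smoothSeries (irrLE F N)) :=
    h0.lt_of_ne fun h' => by rw [← h', mul_zero] at h; exact zero_ne_one h
  rw [eq_inv_of_mul_eq_one_left h]
  rw [← inv_inv (1 - t)]
  exact inv_anti₀ h2 h1

lemma tendsto_prod_irrLE (ht : 0 ≤ t) (ht1 : t < 1) :
    Filter.Tendsto (fun N => ∏ φ ∈ irrLE F N, (1 - ((Nat.card F : ℝ)⁻¹ * t) ^ φ.natDegree))
      Filter.atTop (nhds (1 - t)) := by
  have h1 : Filter.Tendsto (fun N => evalAt t (smoothSeries (irrLE F N))) Filter.atTop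
      (nhds (∑' n, t ^ n)) := by
    refine tendsto_tsum_of_dominated_convergence (bound := fun n => t ^ n)
      (summable_geometric_of_lt_one ht ht1) (fun n => ?_) (Filter.Eventually.of_forall fun N n => ?_)
    · refine tendsto_const_nhds.congr' ?_
      filter_upwards [Filter.eventually_ge_atTop n] with N hN
      rw [coeff_smoothSeries_irrLE hN, one_mul]
    · rw [norm_mul, Real.norm_eq_abs, abs_of_nonneg (coeff_smoothSeries_nonneg _ _),
        Real.norm_of_nonneg (pow_nonneg ht _)]
      exact mul_le_of_le_one_left (pow_nonneg ht _) (coeff_smoothSeries_le_one _ n)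
  rw [tsum_geometric_of_lt_one ht ht1] at h1
  have h2 := h1.inv₀ (inv_ne_zero (by linarith))
  rw [inv_inv] at h2
  refine h2.congr fun N => ?_
  rw [eq_inv_of_mul_eq_one_left (prod_one_sub_mul_evalAt ht ht1 (irrLE F N)
    fun φ hφ => ⟨(mem_irrLE.1 hφ).1, (mem_irrLE.1 hφ).2.1⟩)]

end Evaluate

end Zeta

section LocalFactors

open PowerSeries Finset

/-- The power series `∑ a m * u ^ (d * m)`. -/
noncomputable def dilate (d : ℕ) (a : ℕ → ℝ) : ℝ⟦X⟧ :=
  mk fun n => if d ∣ n then a (n / d) else 0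

lemma hasSum_dilate_iff {d : ℕ} (hd : d ≠ 0) (a : ℕ → ℝ) (t s : ℝ) :
    HasSum (fun n => (if d ∣ n then a (n / d) else 0) * t ^ n) s ↔
      HasSum (fun m => a m * (t ^ d) ^ m) s := by
  rw [← (mul_right_injective₀ hd).hasSum_iff (f := fun n => (if d ∣ n then a (n / d) else 0) * t ^ n)]
  · refine iff_of_eq (congrArg (HasSum · s) ?_)
    funext m
    simp only [Function.comp_apply, dvd_mul_right, if_true,
      Nat.mul_div_cancel_left m (Nat.pos_of_ne_zero hd), pow_mul]
  · intro n hn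
    rw [if_neg, zero_mul]
    rintro ⟨m, rfl⟩
    exact hn ⟨m, rfl⟩

lemma hasSum_abs_dilate_iff {d : ℕ} (hd : d ≠ 0) (a : ℕ → ℝ) (t s : ℝ) :
    HasSum (fun n => |coeff n (dilate d a)| * t ^ n) s ↔
      HasSum (fun m => |a m| * (t ^ d) ^ m) s := by
  rw [← hasSum_dilate_iff hd (fun m => |a m|)]
  simp only [dilate, coeff_mk, apply_ite abs, abs_zero]

lemma summableAt_dilate_iff {d : ℕ} (hd : d ≠ 0) (a : ℕ → ℝ) (t : ℝ) :
    SummableAt t (dilate d a) ↔ Summable fun m => |a m| * (t ^ d) ^ m :=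
  exists_congr fun s => hasSum_abs_dilate_iff hd a t s

lemma majorant_dilate {d : ℕ} (hd : d ≠ 0) {a : ℕ → ℝ} {t : ℝ}
    (h : Summable fun m => |a m| * (t ^ d) ^ m) :
    majorant t (dilate d a) = ∑' m, |a m| * (t ^ d) ^ m :=
  ((hasSum_abs_dilate_iff hd a t _).2 h.hasSum).tsum_eq

lemma evalAt_dilate {d : ℕ} (hd : d ≠ 0) {a : ℕ → ℝ} {t : ℝ}
    (h : Summable fun m => a m * (t ^ d) ^ m) :
    evalAt t (dilate d a) = ∑' m, a m * (t ^ d) ^ m := by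
  simp only [evalAt, dilate, coeff_mk]
  exact ((hasSum_dilate_iff hd a t _).2 h.hasSum).tsum_eq

lemma eulerFactor_mul_dilate (q : ℕ) {d : ℕ} (hd : d ≠ 0) (a : ℕ → ℝ) :
    eulerFactor q d * dilate d a =
      dilate d fun m => a m - if m = 0 then 0 else (q : ℝ)⁻¹ ^ d * a (m - 1) := by
  ext n
  rw [eulerFactor, sub_mul, one_mul, map_sub, mul_assoc, coeff_C_mul, coeff_X_pow_mul']
  simp only [dilate, coeff_mk]
  by_cases hn : d ∣ n
  · obtain ⟨m, rfl⟩ := hn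
    have hd' := Nat.pos_of_ne_zero hd
    rw [if_pos (dvd_mul_right d m), if_pos (dvd_mul_right d m), Nat.mul_div_cancel_left m hd']
    rcases m with _ | m
    · rw [if_neg (by omega), if_pos rfl, mul_zero]
    · have h : d * (m + 1) - d = d * m := by rw [Nat.mul_succ, Nat.add_sub_cancel]
      rw [if_pos (Nat.le_mul_of_pos_right d m.succ_pos), h, if_pos (dvd_mul_right d m),
        Nat.mul_div_cancel_left m hd', if_neg m.succ_ne_zero, Nat.add_sub_cancel]
  · rw [if_neg hn, if_neg hn]
    split_ifs with h1 h2
    · exact absurd (by simpa [Nat.sub_add_cancel h1] using dvd_add h2 (dvd_refl d)) hn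
    · simp
    · simp

/-- The reciprocal of the order of the general linear group of rank `m` over the field with `Q`
elements. -/
noncomputable def invGl (Q m : ℕ) : ℝ := (glOrd Q m : ℝ)⁻¹

lemma cast_glOrd {Q : ℕ} (hQ : 1 < Q) (m : ℕ) :
    (glOrd Q m : ℝ) = (Q : ℝ) ^ (m * m) * ∏ i ∈ range m, (1 - (Q : ℝ)⁻¹ ^ (i + 1)) := by
  have hQ0 : (Q : ℝ) ≠ 0 := by positivity
  have h : (Q : ℝ) ^ (m * m) = ∏ _i ∈ range m, (Q : ℝ) ^ m := by
    rw [prod_const, card_range, pow_mul]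
  rw [glOrd, Fin.prod_univ_eq_prod_range (fun i => Q ^ m - Q ^ i), Nat.cast_prod,
    ← prod_range_reflect (fun i => 1 - (Q : ℝ)⁻¹ ^ (i + 1)), h, ← prod_mul_distrib]
  refine prod_congr rfl fun i hi => ?_
  rw [mem_range] at hi
  have h : m - 1 - i + 1 = m - i := by omega
  rw [Nat.cast_sub (Nat.pow_le_pow_right hQ.le hi.le), h, Nat.cast_pow, Nat.cast_pow, mul_sub,
    mul_one, inv_pow, ← pow_sub_mul_pow (Q : ℝ) hi.le]
  field_simp

lemma invGl_eq {Q : ℕ} (hQ : 1 < Q) (m : ℕ) :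
    invGl Q m = (Q : ℝ)⁻¹ ^ (m * m) * invPoch (Q : ℝ)⁻¹ m := by
  rw [invGl, cast_glOrd hQ, invPoch_natCast, mul_inv, inv_pow]

lemma invGl_zero (Q : ℕ) : invGl Q 0 = 1 := by simp [invGl, glOrd]

lemma invGl_pos {Q : ℕ} (hQ : 1 < Q) (m : ℕ) : 0 < invGl Q m :=
  inv_pos.2 (Nat.cast_pos.2 (glOrd_pos hQ m))

lemma invGl_succ {Q : ℕ} (hQ : 1 < Q) (m : ℕ) :
    ((Q : ℝ) ^ (m + 1) - 1) * invGl Q (m + 1) = (Q : ℝ)⁻¹ ^ m * invGl Q m := by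
  have hQ0 : (1 : ℝ) < Q := by exact_mod_cast hQ
  have h1 : (Q : ℝ) ^ (m + 1) - 1 ≠ 0 := (sub_pos.2 (one_lt_pow₀ hQ0 m.succ_ne_zero)).ne'
  have h2 : ∏ i ∈ range m, (1 - (Q : ℝ)⁻¹ ^ (i + 1)) ≠ 0 := by
    refine prod_ne_zero_iff.2 fun i _ => (sub_pos.2 (pow_lt_one₀ (by positivity)
      (inv_lt_one_of_one_lt₀ hQ0) i.succ_ne_zero)).ne'
  have h3 : (1 - (Q : ℝ)⁻¹ ^ (m + 1)) = (Q : ℝ)⁻¹ ^ (m + 1) * ((Q : ℝ) ^ (m + 1) - 1) := by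
    rw [mul_sub, ← mul_pow, inv_mul_cancel₀ (by positivity), one_pow, mul_one]
  rw [invGl, invGl, cast_glOrd hQ, cast_glOrd hQ, prod_range_succ, h3]
  have : (m + 1) * (m + 1) = m * m + m + (m + 1) := by ring
  have h4 : (Q : ℝ) ^ (m * m) ≠ 0 := by positivity
  have h5 : (Q : ℝ) ^ m ≠ 0 := by positivity
  have h6 : (Q : ℝ) ^ (m + 1) ≠ 0 := by positivity
  rw [this, pow_add _ _ (m + 1), pow_add _ (m * m), inv_pow, inv_pow]
  generalize (Q : ℝ) ^ (m + 1) = A at *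
  generalize ∏ i ∈ range m, (1 - (Q : ℝ)⁻¹ ^ (i + 1)) = P at *
  generalize (Q : ℝ) ^ (m * m) = B at *
  generalize (Q : ℝ) ^ m = D at *
  field_simp

lemma invGl_succ_le {Q : ℕ} (hQ : 1 < Q) {m : ℕ} (hm : m ≠ 0) :
    invGl Q (m + 1) ≤ (Q : ℝ)⁻¹ * invGl Q m := by
  have hQ0 : (2 : ℝ) ≤ Q := by exact_mod_cast hQ
  have h1 : (1 : ℝ) ≤ (Q : ℝ) ^ (m + 1) - 1 := by
    have : (2 : ℝ) ≤ (Q : ℝ) ^ (m + 1) := hQ0.trans (le_self_pow₀ (by linarith) m.succ_ne_zero)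
    linarith
  calc invGl Q (m + 1) ≤ ((Q : ℝ) ^ (m + 1) - 1) * invGl Q (m + 1) :=
        le_mul_of_one_le_left (invGl_pos hQ _).le h1
    _ = (Q : ℝ)⁻¹ ^ m * invGl Q m := invGl_succ hQ m
    _ ≤ (Q : ℝ)⁻¹ * invGl Q m := mul_le_mul_of_nonneg_right
        (pow_le_of_le_one (by positivity) (inv_le_one_of_one_le₀ (by linarith)) hm)
        (invGl_pos hQ _).le

lemma invGl_one {Q : ℕ} (hQ : 1 < Q) : invGl Q 1 = ((Q : ℝ) - 1)⁻¹ := by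
  rw [invGl, glOrd, Fin.prod_univ_one, Fin.val_zero, pow_one, pow_zero, Nat.cast_sub hQ.le,
    Nat.cast_one]

lemma invGl_le {Q : ℕ} (hQ : 1 < Q) (m : ℕ) : invGl Q m ≤ 2 * (Q : ℝ)⁻¹ ^ m := by
  have hQ0 : (2 : ℝ) ≤ Q := by exact_mod_cast hQ
  induction m with
  | zero => rw [invGl_zero]; norm_num
  | succ m ih =>
    rcases eq_or_ne m 0 with rfl | hm
    · rw [zero_add, invGl_one hQ, pow_one, ← div_eq_mul_inv, inv_eq_one_div,
        div_le_div_iff₀ (by linarith) (by linarith)]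
      linarith
    · refine (invGl_succ_le hQ hm).trans ((mul_le_mul_of_nonneg_left ih (by positivity)).trans_eq ?_)
      rw [pow_succ]
      ring

/-- The normalised local factor attached to an irreducible polynomial of degree `d`. -/
noncomputable def localFactor (q d : ℕ) : ℝ⟦X⟧ := eulerFactor q d * dilate d (invGl (q ^ d))

lemma abs_localCoeff_le {Q : ℕ} (hQ : 1 < Q) (m : ℕ) :
    |invGl Q (m + 1) - (Q : ℝ)⁻¹ * invGl Q m| ≤
      if m = 0 then 2 * (Q : ℝ)⁻¹ ^ 2 else 2 * (Q : ℝ)⁻¹ ^ (m + 1) := by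
  have hQ0 : (2 : ℝ) ≤ Q := by exact_mod_cast hQ
  split_ifs with hm
  · subst hm
    have h : ((Q : ℝ) - 1)⁻¹ - (Q : ℝ)⁻¹ = ((Q : ℝ) - 1)⁻¹ * (Q : ℝ)⁻¹ := by
      have : (Q : ℝ) - 1 ≠ 0 := by linarith
      field_simp
      ring
    rw [zero_add, invGl_one hQ, invGl_zero, mul_one, h, abs_of_nonneg
      (mul_nonneg (inv_nonneg.2 (by linarith)) (by positivity)), pow_two, ← mul_assoc,
      ← invGl_one hQ]
    refine mul_le_mul_of_nonneg_right ?_ (by positivity)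
    simpa using invGl_le hQ 1
  · have h1 := invGl_succ_le hQ hm
    have h2 := invGl_pos hQ (m + 1)
    rw [abs_of_nonpos (by linarith)]
    calc -(invGl Q (m + 1) - (Q : ℝ)⁻¹ * invGl Q m) ≤ (Q : ℝ)⁻¹ * invGl Q m := by linarith
      _ ≤ (Q : ℝ)⁻¹ * (2 * (Q : ℝ)⁻¹ ^ m) :=
        mul_le_mul_of_nonneg_left (invGl_le hQ m) (by positivity)
      _ = 2 * (Q : ℝ)⁻¹ ^ (m + 1) := by rw [pow_succ]; ring

lemma abs_localCoeff_mul_pow_le {Q : ℕ} (hQ : 1 < Q) {T : ℝ} (hT : 1 ≤ T)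
    (hw : (Q : ℝ)⁻¹ * T ≤ 3 / 5) (m : ℕ) :
    |invGl Q (m + 1) - (Q : ℝ)⁻¹ * invGl Q m| * T ^ (m + 1) ≤
      4 * ((Q : ℝ)⁻¹ * T) ^ 2 * (3 / 5) ^ m := by
  refine (mul_le_mul_of_nonneg_right (abs_localCoeff_le hQ m) (by positivity)).trans ?_
  have hy : 0 ≤ (Q : ℝ)⁻¹ := by positivity
  rcases m with _ | m
  · simp only [if_true, zero_add, pow_one, pow_zero, mul_one]
    have : T ≤ T ^ 2 := le_self_pow₀ hT two_ne_zero
    rw [mul_pow]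
    nlinarith [mul_le_mul_of_nonneg_left this (sq_nonneg (Q : ℝ)⁻¹), sq_nonneg ((Q : ℝ)⁻¹ * T)]
  · rw [if_neg m.succ_ne_zero, mul_assoc, ← mul_pow]
    have h : ((Q : ℝ)⁻¹ * T) ^ m ≤ (3 / 5) ^ m := pow_le_pow_left₀ (by positivity) hw m
    have h3 : (0 : ℝ) < (3 / 5) ^ m := by positivity
    rw [pow_succ (3 / 5 : ℝ) m]
    have := mul_le_mul_of_nonneg_left h (sq_nonneg ((Q : ℝ)⁻¹ * T))
    rw [show m + 1 + 1 = m + 2 from rfl, pow_add]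
    nlinarith [mul_nonneg (sq_nonneg ((Q : ℝ)⁻¹ * T)) h3.le]

lemma localFactor_bound {q d : ℕ} (hq : 1 < q) (hd : d ≠ 0) {r : ℝ} (hr : 1 ≤ r)
    (hrq : (q : ℝ)⁻¹ * r ≤ 3 / 5) :
    SummableAt r (localFactor q d) ∧
      majorant r (localFactor q d) ≤ 1 + 10 * (((q : ℝ)⁻¹ * r) ^ 2) ^ d := by
  have hQ : 1 < q ^ d := Nat.one_lt_pow hd hq
  have hQc : ((q ^ d : ℕ) : ℝ)⁻¹ = (q : ℝ)⁻¹ ^ d := by rw [Nat.cast_pow, inv_pow]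
  have hT : 1 ≤ r ^ d := one_le_pow₀ hr
  have hw : ((q ^ d : ℕ) : ℝ)⁻¹ * r ^ d ≤ 3 / 5 := by
    rw [hQc, ← mul_pow]
    exact (pow_le_of_le_one (by positivity) (by linarith) hd).trans hrq
  have hb := abs_localCoeff_mul_pow_le hQ hT hw
  set a : ℕ → ℝ := fun m => invGl (q ^ d) m -
    if m = 0 then 0 else (q : ℝ)⁻¹ ^ d * invGl (q ^ d) (m - 1) with ha
  have hg : HasSum (fun m => 4 * (((q ^ d : ℕ) : ℝ)⁻¹ * r ^ d) ^ 2 * (3 / 5 : ℝ) ^ m)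
      (10 * (((q : ℝ)⁻¹ * r) ^ 2) ^ d) := by
    have h := (hasSum_geometric_of_lt_one (r := (3 / 5 : ℝ)) (by norm_num) (by norm_num)).mul_left
      (4 * (((q ^ d : ℕ) : ℝ)⁻¹ * r ^ d) ^ 2)
    have h' : 10 * (((q : ℝ)⁻¹ * r) ^ 2) ^ d =
        4 * (((q ^ d : ℕ) : ℝ)⁻¹ * r ^ d) ^ 2 * (1 - 3 / 5)⁻¹ := by
      rw [hQc, ← mul_pow, ← pow_mul, ← pow_mul, mul_comm d 2]
      ring
    rw [h']
    exact h
  have hsucc : ∀ m, |a (m + 1)| * (r ^ d) ^ (m + 1) ≤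
      4 * (((q ^ d : ℕ) : ℝ)⁻¹ * r ^ d) ^ 2 * (3 / 5) ^ m := fun m => by
    have := hb m
    rw [hQc] at this
    rw [hQc]
    simpa [ha] using this
  have hs : Summable fun m => |a (m + 1)| * (r ^ d) ^ (m + 1) :=
    Summable.of_nonneg_of_le (fun m => by positivity) hsucc hg.summable
  have hs' : Summable fun m => |a m| * (r ^ d) ^ m :=
    (summable_nat_add_iff (f := fun m => |a m| * (r ^ d) ^ m) 1).1 hs
  rw [localFactor, eulerFactor_mul_dilate q hd]
  refine ⟨(summableAt_dilate_iff hd a r).2 hs', ?_⟩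
  rw [majorant_dilate hd hs', hs'.tsum_eq_zero_add]
  refine add_le_add (by simp [ha, invGl_zero]) ?_
  exact (hs.tsum_le_tsum hsucc hg.summable).trans_eq hg.tsum_eq

lemma progProd_five_one {x : ℝ} (h0 : 0 < x) (h1 : x < 1) :
    progProd x 5 1 = (1 - x) * progProd x 5 6 := by
  rw [progProd, tprod_eq_zero_mul']
  · simp [progProd, mul_add, add_assoc]
  · simpa [mul_add, add_assoc] using multipliable_progProd h0 h1 (a := 5) (by norm_num) 6

lemma evalAt_localFactor {q d : ℕ} (hq : 1 < q) (hd : d ≠ 0) :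
    evalAt 1 (localFactor q d) = (progProd ((q : ℝ)⁻¹ ^ d) 5 6 * progProd ((q : ℝ)⁻¹ ^ d) 5 4)⁻¹ := by
  have hQ : 1 < q ^ d := Nat.one_lt_pow hd hq
  have hQc : ((q ^ d : ℕ) : ℝ)⁻¹ = (q : ℝ)⁻¹ ^ d := by rw [Nat.cast_pow, inv_pow]
  set y := (q : ℝ)⁻¹ ^ d
  have hy0 : 0 < y := by positivity
  have hy1 : y < 1 := pow_lt_one₀ (by positivity) (inv_lt_one_of_one_lt₀ (by exact_mod_cast hq)) hd
  have h1 : ∀ m : ℕ, invGl (q ^ d) m = y ^ (m * (m + 0)) * invPoch y m := fun m => by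
    rw [invGl_eq hQ, hQc, add_zero]
  have hs := summable_rogersRamanujan hy0 hy1 0
  have hs1 : Summable fun m => invGl (q ^ d) m * ((1 : ℝ) ^ d) ^ m := by
    simpa only [one_pow, mul_one, h1] using hs
  have hs2 : Summable fun m => |invGl (q ^ d) m| * ((1 : ℝ) ^ d) ^ m := by
    simpa only [abs_of_pos (invGl_pos hQ _)] using hs1
  have h2 := progProd_five_one hy0 hy1
  rw [localFactor, evalAt_mul zero_le_one (summableAt_eulerFactor _ _ _)
    ((summableAt_dilate_iff hd _ _).2 hs2), evalAt_dilate hd hs1, eulerFactor,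
    evalAt_one_sub_C_mul_X_pow _ hd]
  simp only [one_pow, mul_one, h1]
  have h3 : 1 - y ≠ 0 := by linarith
  rw [rogersRamanujan_one hy0 hy1, h2]
  change (1 - y) * _ = _
  rw [mul_assoc, mul_inv, ← mul_assoc, mul_inv_cancel₀ h3, one_mul]

/-- The contribution of the factor `X - 1` to the affine cycle index. -/
noncomputable def unipotentFactor (q : ℕ) : ℝ⟦X⟧ := mk fun i => ((q : ℝ) ^ i - 1) * invGl q i

lemma coeff_succ_unipotentFactor {q : ℕ} (hq : 1 < q) (i : ℕ) :
    coeff (i + 1) (unipotentFactor q) = (q : ℝ)⁻¹ ^ i * invGl q i := by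
  rw [unipotentFactor, coeff_mk, invGl_succ hq]

lemma coeff_zero_unipotentFactor (q : ℕ) : coeff 0 (unipotentFactor q) = 0 := by
  simp [unipotentFactor]

lemma summableAt_unipotentFactor {q : ℕ} (hq : 1 < q) {r : ℝ} (hr : 1 ≤ r)
    (hrq : (q : ℝ)⁻¹ * r ≤ 3 / 5) : SummableAt r (unipotentFactor q) := by
  have hx : 0 ≤ (q : ℝ)⁻¹ := by positivity
  have hx1 : (q : ℝ)⁻¹ ≤ 1 := inv_le_one_of_one_le₀ (by exact_mod_cast hq.le)
  unfold SummableAt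
  rw [← summable_nat_add_iff 1]
  refine Summable.of_nonneg_of_le (fun i => by positivity) (fun i => ?_)
    ((summable_geometric_of_lt_one (r := (3 / 5 : ℝ)) (by norm_num) (by norm_num)).mul_left (2 * r))
  rw [coeff_succ_unipotentFactor hq, abs_of_nonneg (mul_nonneg (by positivity) (invGl_pos hq i).le)]
  calc (q : ℝ)⁻¹ ^ i * invGl q i * r ^ (i + 1) ≤ 1 * (2 * (q : ℝ)⁻¹ ^ i) * r ^ (i + 1) := by
        have := invGl_le hq i
        have := (invGl_pos hq i).le
        gcongr
        exact pow_le_one₀ hx hx1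
    _ = 2 * r * ((q : ℝ)⁻¹ * r) ^ i := by rw [mul_pow, pow_succ]; ring
    _ ≤ 2 * r * (3 / 5) ^ i := by gcongr

lemma evalAt_unipotentFactor {q : ℕ} (hq : 1 < q) :
    evalAt 1 (unipotentFactor q) = (progProd (q : ℝ)⁻¹ 5 2 * progProd (q : ℝ)⁻¹ 5 3)⁻¹ := by
  have hy0 : 0 < (q : ℝ)⁻¹ := by positivity
  have hy1 : (q : ℝ)⁻¹ < 1 := inv_lt_one_of_one_lt₀ (by exact_mod_cast hq)
  have h1 : ∀ i : ℕ, coeff (i + 1) (unipotentFactor q) * 1 ^ (i + 1) =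
      (q : ℝ)⁻¹ ^ (i * (i + 1)) * invPoch (q : ℝ)⁻¹ i := fun i => by
    rw [coeff_succ_unipotentFactor hq, invGl_eq hq, ← mul_assoc, ← pow_add, one_pow, mul_one]
    ring_nf
  have hs : Summable fun i => coeff i (unipotentFactor q) * (1 : ℝ) ^ i := by
    rw [← summable_nat_add_iff 1]
    simp only [h1]
    exact summable_rogersRamanujan hy0 hy1 1
  rw [evalAt, hs.tsum_eq_zero_add, coeff_zero_unipotentFactor, zero_mul, zero_add]
  simp only [h1]
  exact rogersRamanujan_two hy0 hy1

end LocalFactors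

section AffineSeries

open Polynomial Finset Filter Topology

section General

variable {F : Type*} [Field F] [Finite F]

open Classical in
/-- The monic irreducible polynomials of degree at most `N` other than `X` and `X - 1`. -/
noncomputable def irrRest (F : Type*) [Field F] [Finite F] (N : ℕ) : Finset F[X] :=
  irrLE F N \ {X, X - C 1}

lemma irrProd_eq (N : ℕ) : irrProd F N = ∏ φ ∈ irrRest F N, φ := rfl

lemma irrRest_subset (N : ℕ) : irrRest F N ⊆ irrLE F N := by
  classical
  exact sdiff_subset

lemma monic_irreducible_of_mem_irrRest {N : ℕ} {φ : F[X]} (h : φ ∈ irrRest F N) :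
    φ.Monic ∧ Irreducible φ :=
  let h' := mem_irrLE.1 (irrRest_subset N h)
  ⟨h'.1, h'.2.1⟩

lemma natDegree_ne_zero_of_mem_irrRest {N : ℕ} {φ : F[X]} (h : φ ∈ irrRest F N) :
    φ.natDegree ≠ 0 :=
  (monic_irreducible_of_mem_irrRest h).2.natDegree_pos.ne'

lemma prod_irrLE_eq {M : Type*} [CommMonoid M] {N : ℕ} (hN : 1 ≤ N) (f : ℕ → M) :
    ∏ φ ∈ irrLE F N, f φ.natDegree = f 1 ^ 2 * ∏ φ ∈ irrRest F N, f φ.natDegree := by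
  classical
  have h : ({X, X - C 1} : Finset F[X]) ⊆ irrLE F N := by
    intro φ hφ
    rw [mem_insert, mem_singleton] at hφ
    rw [mem_irrLE]
    rcases hφ with rfl | rfl
    · exact ⟨monic_X, irreducible_X, by rwa [natDegree_X]⟩
    · exact ⟨monic_X_sub_C _, irreducible_X_sub_C _, by rwa [natDegree_X_sub_C]⟩
  have hne : (X : F[X]) ≠ X - C 1 := by
    intro h
    rw [eq_comm, sub_eq_self] at h
    simp at h
  rw [← prod_sdiff h, prod_pair hne, natDegree_X, natDegree_X_sub_C, mul_comm, pow_two, irrRest]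

lemma mk_annRatio_irreducible {φ : F[X]} (hφ : Irreducible φ) :
    PowerSeries.mk (annRatio φ) = dilate φ.natDegree (invGl (Nat.card F ^ φ.natDegree)) := by
  ext n
  rw [dilate, PowerSeries.coeff_mk, PowerSeries.coeff_mk]
  split_ifs with h
  · obtain ⟨m, rfl⟩ := h
    rw [Nat.mul_div_cancel_left m hφ.natDegree_pos, mul_comm, annRatio_irreducible φ hφ, invGl]
  · exact annRatio_irreducible_of_not_dvd φ hφ h

lemma mk_annRatio_prod (S : Finset F[X]) (hS : ∀ φ ∈ S, φ.Monic ∧ Irreducible φ) :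
    PowerSeries.mk (annRatio (∏ φ ∈ S, φ)) =
      ∏ φ ∈ S, dilate φ.natDegree (invGl (Nat.card F ^ φ.natDegree)) := by
  classical
  induction S using Finset.induction_on with
  | empty =>
    ext n
    rw [prod_empty, prod_empty, PowerSeries.coeff_mk, annRatio_one, PowerSeries.coeff_one]
  | insert φ S hφ ih =>
    have hS' : ∀ ψ ∈ S, ψ.Monic ∧ Irreducible ψ := fun ψ hψ => hS ψ (mem_insert_of_mem hψ)
    obtain ⟨hm, hi⟩ := hS φ (mem_insert_self _ _)
    rw [prod_insert hφ, prod_insert hφ, ← ih hS', ← mk_annRatio_irreducible hi]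
    ext n
    rw [PowerSeries.coeff_mul, PowerSeries.coeff_mk,
      annRatio_mul (isCoprime_prod_of_monic_irreducible hm hi hS' hφ)]
    simp only [PowerSeries.coeff_mk]

/-- The truncated affine semisimple cycle index times the truncated Euler product. -/
noncomputable def affSeries (F : Type*) [Field F] [Finite F] (N : ℕ) : PowerSeries ℝ :=
  unipotentFactor (Nat.card F) * eulerFactor (Nat.card F) 1 ^ 2 *
    ∏ φ ∈ irrRest F N, localFactor (Nat.card F) φ.natDegree

lemma affSeries_eq {N : ℕ} (hN : 1 ≤ N) :
    affSeries F N = unipotentFactor (Nat.card F) * PowerSeries.mk (annRatio (irrProd F N)) *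
      ∏ φ ∈ irrLE F N, eulerFactor (Nat.card F) φ.natDegree := by
  rw [irrProd_eq, mk_annRatio_prod _ fun φ hφ => monic_irreducible_of_mem_irrRest hφ,
    prod_irrLE_eq hN fun d => eulerFactor (Nat.card F) d, affSeries]
  simp only [localFactor, prod_mul_distrib]
  ring

lemma inv_card_le : (Nat.card F : ℝ)⁻¹ ≤ 1 / 2 := by
  have h : (2 : ℝ) ≤ Nat.card F := by exact_mod_cast Finite.one_lt_card (α := F)
  rw [one_div]
  exact inv_anti₀ (by norm_num) h

lemma inv_card_pos : 0 < (Nat.card F : ℝ)⁻¹ := inv_pos.2 (by exact_mod_cast Nat.card_pos (α := F))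

lemma summableAt_affFactors (N : ℕ) :
    SummableAt (6 / 5) (unipotentFactor (Nat.card F)) ∧
    SummableAt (6 / 5) (eulerFactor (Nat.card F) 1 ^ 2) ∧
    ∀ φ ∈ irrRest F N, SummableAt (6 / 5) (localFactor (Nat.card F) φ.natDegree) := by
  have hq : 1 < Nat.card F := Finite.one_lt_card
  have hx := inv_card_le (F := F)
  refine ⟨summableAt_unipotentFactor hq (by norm_num) (by linarith), ?_, fun φ hφ =>
    (localFactor_bound hq (natDegree_ne_zero_of_mem_irrRest hφ) (by norm_num) (by linarith)).1⟩
  rw [pow_two]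
  exact SummableAt.mul (by norm_num) (summableAt_eulerFactor _ _ _) (summableAt_eulerFactor _ _ _)

lemma summableAt_affSeries (N : ℕ) : SummableAt (6 / 5) (affSeries F N) := by
  obtain ⟨h1, h2, h3⟩ := summableAt_affFactors (F := F) N
  exact (h1.mul (by norm_num) h2).mul (by norm_num) (SummableAt.prod (by norm_num) _ _ h3)

lemma one_add_ten_mul_le {w : ℝ} (h0 : 0 ≤ w) (h1 : w < 1) : 1 + 10 * w ≤ ((1 - w) ^ 10)⁻¹ := by
  have h2 : 1 + w ≤ (1 - w)⁻¹ := by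
    rw [inv_eq_one_div, le_div_iff₀ (by linarith)]
    nlinarith
  calc 1 + 10 * w ≤ (1 + w) ^ 10 := by
        have := one_add_mul_le_pow (a := w) (by linarith) 10
        exact_mod_cast this
    _ ≤ ((1 - w)⁻¹) ^ 10 := pow_le_pow_left₀ (by linarith) h2 10
    _ = ((1 - w) ^ 10)⁻¹ := inv_pow _ _

lemma prod_irrLE_le_prod_irrRest {x : ℝ} (h0 : 0 ≤ x) (h1 : x < 1) (N : ℕ) :
    ∏ φ ∈ irrLE F N, (1 - x ^ φ.natDegree) ≤ ∏ φ ∈ irrRest F N, (1 - x ^ φ.natDegree) := by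
  refine prod_le_prod_of_subset_of_le_one (irrRest_subset N) (fun φ _ => ?_) fun φ _ _ => ?_
  · exact sub_nonneg.2 (pow_le_one₀ h0 h1.le)
  · exact sub_le_self _ (pow_nonneg h0 _)

lemma exists_majorant_affSeries_le :
    ∃ M : ℝ, ∀ N, majorant (6 / 5) (affSeries F N) ≤ M := by
  have hq : 1 < Nat.card F := Finite.one_lt_card
  have hx := inv_card_le (F := F)
  have hx0 := inv_card_pos (F := F)
  set x := (Nat.card F : ℝ)⁻¹ with hxdef
  set t := x * (6 / 5) ^ 2 with ht
  have ht0 : 0 ≤ t := by positivity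
  have ht1 : t < 1 := by
    rw [ht]
    nlinarith
  have hw0 : 0 ≤ x * t := by positivity
  have hw1 : x * t < 1 := by nlinarith
  refine ⟨majorant (6 / 5) (unipotentFactor (Nat.card F)) *
    majorant (6 / 5) (eulerFactor (Nat.card F) 1 ^ 2) * ((1 - t) ^ 10)⁻¹, fun N => ?_⟩
  obtain ⟨h1, h2, h3⟩ := summableAt_affFactors (F := F) N
  have hr : (0 : ℝ) ≤ 6 / 5 := by norm_num
  refine (majorant_mul_le hr (h1.mul hr h2) (SummableAt.prod hr _ _ h3)).trans ?_
  refine mul_le_mul (majorant_mul_le hr h1 h2) ?_ (majorant_nonneg hr)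
    (mul_nonneg (majorant_nonneg hr) (majorant_nonneg hr))
  refine (majorant_prod_le hr _ _ h3).trans ?_
  calc ∏ φ ∈ irrRest F N, majorant (6 / 5) (localFactor (Nat.card F) φ.natDegree)
      ≤ ∏ φ ∈ irrRest F N, ((1 - (x * t) ^ φ.natDegree) ^ 10)⁻¹ := by
        refine prod_le_prod (fun φ _ => majorant_nonneg hr) fun φ hφ => ?_
        have hd := natDegree_ne_zero_of_mem_irrRest hφ
        refine (localFactor_bound hq hd (by norm_num) (by linarith)).2.trans ?_
        have : (x * (6 / 5)) ^ 2 = x * t := by rw [ht]; ring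
        rw [← hxdef, this]
        exact one_add_ten_mul_le (pow_nonneg hw0 _) (pow_lt_one₀ hw0 hw1 hd)
    _ = ((∏ φ ∈ irrRest F N, (1 - (x * t) ^ φ.natDegree)) ^ 10)⁻¹ := by
        rw [prod_inv_distrib, prod_pow]
    _ ≤ ((1 - t) ^ 10)⁻¹ := by
        refine inv_anti₀ (pow_pos (by linarith) _) (pow_le_pow_left₀ (by linarith) ?_ _)
        exact (one_sub_le_prod_irrLE ht0 ht1 N).trans (prod_irrLE_le_prod_irrRest hw0 hw1 N)

lemma prod_irrRest_bounds {s : ℕ} (hs : s ≠ 0) (N : ℕ) :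
    1 - (Nat.card F : ℝ)⁻¹ ^ s ≤
        ∏ φ ∈ irrRest F N, (1 - ((Nat.card F : ℝ)⁻¹ ^ φ.natDegree) ^ (s + 1)) ∧
      ∏ φ ∈ irrRest F N, (1 - ((Nat.card F : ℝ)⁻¹ ^ φ.natDegree) ^ (s + 1)) ≤ 1 := by
  have hx := inv_card_le (F := F)
  have hx0 := inv_card_pos (F := F)
  set x := (Nat.card F : ℝ)⁻¹
  have hx1 : x < 1 := by linarith
  have e : ∀ d : ℕ, (x ^ d) ^ (s + 1) = (x * x ^ s) ^ d := fun d => by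
    rw [← pow_succ', ← pow_mul, ← pow_mul, mul_comm]
  have h0 : 0 ≤ x * x ^ s := by positivity
  have h1 : x * x ^ s < 1 := by
    rw [← pow_succ']
    exact pow_lt_one₀ hx0.le hx1 s.succ_ne_zero
  simp only [e]
  refine ⟨?_, prod_le_one (fun φ _ => sub_nonneg.2 (pow_le_one₀ h0 h1.le)) fun φ _ =>
    sub_le_self _ (pow_nonneg h0 _)⟩
  exact (one_sub_le_prod_irrLE (pow_nonneg hx0.le s) (pow_lt_one₀ hx0.le hx1 hs) N).trans
    (prod_irrLE_le_prod_irrRest h0 h1 N)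

lemma tendsto_prod_irrRest {s : ℕ} (hs : s ≠ 0) :
    Tendsto (fun N => ∏ φ ∈ irrRest F N, (1 - ((Nat.card F : ℝ)⁻¹ ^ φ.natDegree) ^ (s + 1)))
      atTop (𝓝 ((1 - (Nat.card F : ℝ)⁻¹ ^ s) / (1 - (Nat.card F : ℝ)⁻¹ ^ (s + 1)) ^ 2)) := by
  have hx := inv_card_le (F := F)
  have hx0 := inv_card_pos (F := F)
  have ht := tendsto_prod_irrLE (F := F) (pow_nonneg hx0.le s) (pow_lt_one₀ hx0.le (by linarith) hs)
  set x := (Nat.card F : ℝ)⁻¹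
  have h2 : (1 - x ^ (s + 1)) ^ 2 ≠ 0 :=
    pow_ne_zero _ (sub_pos.2 (pow_lt_one₀ hx0.le (by linarith) s.succ_ne_zero)).ne'
  refine (ht.div_const ((1 - x ^ (s + 1)) ^ 2)).congr' ?_
  filter_upwards [eventually_ge_atTop 1] with N hN
  rw [prod_irrLE_eq hN fun d => 1 - (x * x ^ s) ^ d, pow_one, ← pow_succ',
    mul_div_cancel_left₀ _ h2]
  refine prod_congr rfl fun φ _ => ?_
  rw [← pow_mul, ← pow_mul, mul_comm]

lemma tendsto_prod_progProd {c : ℕ} (hc : c ≠ 0) :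
    Tendsto (fun N => ∏ φ ∈ irrRest F N, progProd ((Nat.card F : ℝ)⁻¹ ^ φ.natDegree) 5 (c + 1))
      atTop (𝓝 (progProd (Nat.card F : ℝ)⁻¹ 5 c / progProd (Nat.card F : ℝ)⁻¹ 5 (c + 1) ^ 2)) := by
  have hx := inv_card_le (F := F)
  have hx0 := inv_card_pos (F := F)
  have hb := fun (s : ℕ) (hs : s ≠ 0) (N : ℕ) => prod_irrRest_bounds (F := F) hs N
  have hl := fun (s : ℕ) (hs : s ≠ 0) => tendsto_prod_irrRest (F := F) hs
  set x := (Nat.card F : ℝ)⁻¹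
  have hx1 : x < 1 := by linarith
  have hsum := summable_pow_prog hx0 hx1 (a := 5) (by norm_num) c
  have hne : ∀ i, 5 * i + c ≠ 0 := fun i => by omega
  set g : ℕ → ℝ := fun i =>
    (1 - x ^ (5 * i + c)) / (1 - x ^ (5 * i + c + 1)) ^ 2 - 1 with hg
  have hbound : ∀ N i,
      ‖∏ φ ∈ irrRest F N, (1 - (x ^ φ.natDegree) ^ (5 * i + c + 1)) - 1‖ ≤ x ^ (5 * i + c) := by
    intro N i
    have := hb (5 * i + c) (hne i) N
    rw [Real.norm_eq_abs, abs_sub_le_iff]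
    have h0 : 0 ≤ x ^ (5 * i + c) := by positivity
    exact ⟨by linarith, by linarith⟩
  have hlim : ∀ i, Tendsto (fun N =>
      ∏ φ ∈ irrRest F N, (1 - (x ^ φ.natDegree) ^ (5 * i + c + 1)) - 1) atTop (𝓝 (g i)) :=
    fun i => (hl (5 * i + c) (hne i)).sub_const 1
  have h := tendsto_tprod_one_add_of_dominated_convergence hsum hlim
    (Eventually.of_forall fun N i => hbound N i)
  have hgs : Summable fun i => g i :=
    Summable.of_norm_bounded hsum fun i =>
      le_of_tendsto' (hlim i).norm fun N => hbound N i
  have hgp : ∏' i, (1 + g i) = progProd x 5 c / progProd x 5 (c + 1) ^ 2 := by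
    refine tendsto_nhds_unique
      (Real.multipliable_one_add_of_summable hgs).tendsto_prod_tprod_nat ?_
    refine ((tendsto_progProd hx0 hx1 (a := 5) (by norm_num) c).div
      ((tendsto_progProd hx0 hx1 (a := 5) (by norm_num) (c + 1)).pow 2)
      (pow_ne_zero _ (progProd_pos hx0 hx1 (by norm_num) c.succ_ne_zero).ne')).congr fun N => ?_
    simp only [Pi.div_apply, hg]
    rw [← prod_pow, ← prod_div_distrib]
    refine prod_congr rfl fun i _ => ?_
    rw [add_sub_cancel, add_assoc]
  rw [← hgp]
  refine h.congr fun N => ?_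
  simp only [add_sub_cancel]
  rw [Multipliable.tprod_finsetProd]
  · rfl
  · intro φ hφ
    exact multipliable_progProd (by positivity)
      (pow_lt_one₀ hx0.le hx1 (natDegree_ne_zero_of_mem_irrRest hφ)) (by norm_num) (c + 1)

lemma evalAt_affSeries (N : ℕ) :
    evalAt 1 (affSeries F N) =
      (progProd (Nat.card F : ℝ)⁻¹ 5 2 * progProd (Nat.card F : ℝ)⁻¹ 5 3)⁻¹ *
        (1 - (Nat.card F : ℝ)⁻¹) ^ 2 *
        ((∏ φ ∈ irrRest F N, progProd ((Nat.card F : ℝ)⁻¹ ^ φ.natDegree) 5 6) *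
          ∏ φ ∈ irrRest F N, progProd ((Nat.card F : ℝ)⁻¹ ^ φ.natDegree) 5 4)⁻¹ := by
  have hq : 1 < Nat.card F := Finite.one_lt_card
  obtain ⟨h1, h2, h3⟩ := summableAt_affFactors (F := F) N
  have hr : (1 : ℝ) ≤ 6 / 5 := by norm_num
  replace h1 := h1.mono zero_le_one hr
  replace h2 := h2.mono zero_le_one hr
  replace h3 := fun φ hφ => (h3 φ hφ).mono zero_le_one hr
  have he := summableAt_eulerFactor 1 (Nat.card F) 1
  rw [affSeries, evalAt_mul zero_le_one (h1.mul zero_le_one h2)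
    (SummableAt.prod zero_le_one _ _ h3), evalAt_mul zero_le_one h1 h2,
    evalAt_prod zero_le_one _ _ h3, evalAt_unipotentFactor hq, pow_two,
    evalAt_mul zero_le_one he he, eulerFactor, evalAt_one_sub_C_mul_X_pow _ one_ne_zero,
    pow_one, pow_one, mul_one, ← pow_two, ← prod_mul_distrib, ← prod_inv_distrib]
  congr 1
  exact prod_congr rfl fun φ hφ => evalAt_localFactor hq (natDegree_ne_zero_of_mem_irrRest hφ)

lemma tendsto_evalAt_affSeries :
    Tendsto (fun N => evalAt 1 (affSeries F N)) atTop
      (𝓝 (progProd (Nat.card F : ℝ)⁻¹ 5 1 ^ 2 * progProd (Nat.card F : ℝ)⁻¹ 5 4 ^ 2 /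
        (progProd (Nat.card F : ℝ)⁻¹ 5 2 * progProd (Nat.card F : ℝ)⁻¹ 5 3 ^ 2 *
          progProd (Nat.card F : ℝ)⁻¹ 5 5))) := by
  have hx := inv_card_le (F := F)
  have hx0 := inv_card_pos (F := F)
  have h6 := tendsto_prod_progProd (F := F) (c := 5) (by norm_num)
  have h4 := tendsto_prod_progProd (F := F) (c := 3) (by norm_num)
  simp only [evalAt_affSeries]
  set x := (Nat.card F : ℝ)⁻¹
  have hx1 : x < 1 := by linarith
  have hpos : ∀ b : ℕ, b ≠ 0 → progProd x 5 b ≠ 0 := fun b hb =>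
    (progProd_pos hx0 hx1 (by norm_num) hb).ne'
  have e2 := hpos 2 (by norm_num)
  have e3 := hpos 3 (by norm_num)
  have e4 := hpos 4 (by norm_num)
  have e5 := hpos 5 (by norm_num)
  have e6 := hpos 6 (by norm_num)
  have h1 : progProd x 5 1 = (1 - x) * progProd x 5 6 := progProd_five_one hx0 hx1
  have hlim := ((h6.mul h4).inv₀ (mul_ne_zero (div_ne_zero e5 (pow_ne_zero _ e6))
    (div_ne_zero e3 (pow_ne_zero _ e4)))).const_mul
      ((progProd x 5 2 * progProd x 5 3)⁻¹ * (1 - x) ^ 2)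
  convert hlim using 2
  rw [h1]
  field_simp

end General

section Proportion

variable (F : Type) [Field F] [Fintype F]

lemma ssA_eq_coeff {n N : ℕ} (hN : n + 1 ≤ N) :
    ssA F n = PowerSeries.coeff (n + 1)
      (unipotentFactor (Nat.card F) * PowerSeries.mk (annRatio (irrProd F N))) := by
  have h : ∀ i, annRatio (X - C 1 : F[X]) i = invGl (Nat.card F) i := fun i => by
    have := annRatio_irreducible (X - C 1 : F[X]) (irreducible_X_sub_C _) i
    rw [natDegree_X_sub_C, mul_one, pow_one] at this
    rw [this, invGl]
  rw [ssA_eq_sum hN, PowerSeries.coeff_mul]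
  simp only [unipotentFactor, PowerSeries.coeff_mk, h, Nat.card_eq_fintype_card]

/-- The increments of the sequence `0, ssA F 0, ssA F 1, …`. -/
noncomputable def ssAIncr : ℕ → ℝ
  | 0 => 0
  | 1 => ssA F 0
  | n + 2 => ssA F (n + 1) - ssA F n

lemma sum_ssAIncr (n : ℕ) : ∑ k ∈ range (n + 2), ssAIncr F k = ssA F n := by
  induction n with
  | zero => simp [sum_range_succ, ssAIncr]
  | succ n ih => rw [sum_range_succ, ih, ssAIncr]; ring

lemma coeff_affSeries {k N : ℕ} (hN : 1 ≤ N) (hk : k ≤ N) :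
    PowerSeries.coeff k (affSeries F N) = ssAIncr F k := by
  rw [affSeries_eq hN, coeff_mul_prod_eulerFactor _ hk, mul_sub, mul_one, map_sub]
  have h0 : PowerSeries.coeff 0
      (unipotentFactor (Nat.card F) * PowerSeries.mk (annRatio (irrProd F N))) = 0 := by
    rw [PowerSeries.coeff_zero_eq_constantCoeff_apply, map_mul,
      ← PowerSeries.coeff_zero_eq_constantCoeff_apply, coeff_zero_unipotentFactor, zero_mul]
  match k, hk with
  | 0, _ => rw [h0, PowerSeries.coeff_zero_mul_X, ssAIncr, sub_zero]
  | 1, hk => rw [PowerSeries.coeff_succ_mul_X, h0, ← ssA_eq_coeff F hk, ssAIncr, sub_zero]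
  | k + 2, hk =>
    rw [PowerSeries.coeff_succ_mul_X, ← ssA_eq_coeff F hk, ← ssA_eq_coeff F (by omega), ssAIncr]

lemma tendsto_ssA {L : ℝ} (hL : Tendsto (fun N => evalAt 1 (affSeries F N)) atTop (𝓝 L)) :
    Tendsto (fun n => ssA F n) atTop (𝓝 L) := by
  obtain ⟨M, hM⟩ := exists_majorant_affSeries_le (F := F)
  have hbound : ∀ N k, ‖PowerSeries.coeff k (affSeries F N) * 1 ^ k‖ ≤ M * (5 / 6) ^ k := by
    intro N k
    have h := ((summableAt_affSeries (F := F) N).abs_coeff_mul_le (by norm_num) k).trans (hM N)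
    rw [one_pow, mul_one, Real.norm_eq_abs]
    calc |PowerSeries.coeff k (affSeries F N)|
        = |PowerSeries.coeff k (affSeries F N)| * (6 / 5) ^ k * (5 / 6) ^ k := by
          rw [mul_assoc, ← mul_pow]
          norm_num
      _ ≤ M * (5 / 6) ^ k := mul_le_mul_of_nonneg_right h (by positivity)
  have hsum : Summable fun k : ℕ => M * (5 / 6 : ℝ) ^ k :=
    (summable_geometric_of_lt_one (by norm_num) (by norm_num)).mul_left M
  have hlim : ∀ k, Tendsto (fun N => PowerSeries.coeff k (affSeries F N) * (1 : ℝ) ^ k) atTop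
      (𝓝 (ssAIncr F k)) := by
    intro k
    refine tendsto_const_nhds.congr' ?_
    filter_upwards [eventually_ge_atTop (k + 1)] with N hN
    rw [one_pow, mul_one, coeff_affSeries F (by omega) (by omega)]
  have h1 : Tendsto (fun N => evalAt 1 (affSeries F N)) atTop (𝓝 (∑' k, ssAIncr F k)) :=
    tendsto_tsum_of_dominated_convergence hsum hlim
      (Eventually.of_forall fun N k => hbound N k)
  have hs : Summable (ssAIncr F) :=
    Summable.of_norm_bounded hsum fun k => le_of_tendsto' (hlim k).norm fun N => hbound N k
  rw [tendsto_nhds_unique hL h1]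
  refine (hs.hasSum.tendsto_sum_nat.comp (tendsto_add_atTop_nat 2)).congr fun n => ?_
  exact sum_ssAIncr F n

end Proportion

end AffineSeries

section ModFive

open Finset Filter Topology

lemma tprod_eq_of_tendsto_five {f : ℕ → ℝ} (hf : Multipliable f) (h0 : f 0 = 1) {L : ℝ}
    (hL : Tendsto (fun N => ∏ i ∈ range N,
      (f (5 * i + 1) * f (5 * i + 2) * f (5 * i + 3) * f (5 * i + 4) * f (5 * i + 5)))
      atTop (𝓝 L)) : ∏' r, f r = L := by
  have h := (hf.tendsto_prod_tprod_nat.comp (tendsto_add_atTop_nat 1)).comp tendsto_five_mul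
  refine tendsto_nhds_unique h (hL.congr fun N => ?_)
  simp only [Function.comp_apply]
  rw [prod_range_succ', h0, mul_one, prod_range_five_mul fun r => f (r + 1)]

lemma multipliable_ite_one_sub {q : ℝ} (hq : 1 < q) (p : ℕ → Prop) [DecidablePred p] (e : ℕ) :
    Multipliable fun r : ℕ => if p r then 1 - 1 / q ^ (r - e) else 1 := by
  have hs : Summable fun r : ℕ => 1 / q ^ (r - e) := by
    rw [← summable_nat_add_iff e]
    simp only [Nat.add_sub_cancel, ← _root_.one_div_pow]
    exact summable_geometric_of_lt_one (by positivity) (by rw [div_lt_one] <;> linarith)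
  have h : ∀ r, (if p r then 1 - 1 / q ^ (r - e) else 1) =
      1 + if p r then -(1 / q ^ (r - e)) else 0 := fun r => by split_ifs <;> ring
  simp only [h]
  refine Real.multipliable_one_add_of_summable (Summable.of_norm_bounded hs fun r => ?_)
  have h0 : 0 ≤ 1 / q ^ (r - e) := by positivity
  split_ifs
  · rw [norm_neg, Real.norm_of_nonneg h0]
  · rwa [norm_zero]

variable {q : ℝ}

lemma tprod_mod_five_one_four (hq : 1 < q) :
    (∏' r : ℕ, if 1 ≤ r ∧ (r % 5 = 0 ∨ r % 5 = 1 ∨ r % 5 = 4) then 1 - 1 / q ^ r else 1) =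
      progProd q⁻¹ 5 1 * progProd q⁻¹ 5 4 * progProd q⁻¹ 5 5 := by
  have hx0 : 0 < q⁻¹ := by positivity
  have hx1 : q⁻¹ < 1 := inv_lt_one_of_one_lt₀ hq
  have e := fun b => tendsto_progProd hx0 hx1 (a := 5) (by norm_num) b
  refine tprod_eq_of_tendsto_five (multipliable_ite_one_sub hq _ 0) (by simp)
    (((e 1).mul (e 4)).mul (e 5) |>.congr fun N => ?_)
  rw [← prod_mul_distrib, ← prod_mul_distrib]
  refine prod_congr rfl fun i _ => ?_
  rw [if_pos (by omega), if_neg (by omega), if_neg (by omega), if_pos (by omega),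
    if_pos (by omega)]
  simp only [one_div, inv_pow, mul_one, Nat.sub_zero]

lemma tprod_mod_five_two_three (hq : 1 < q) :
    (∏' r : ℕ, if 1 ≤ r ∧ (r % 5 = 0 ∨ r % 5 = 2 ∨ r % 5 = 3) then 1 - 1 / q ^ r else 1) =
      progProd q⁻¹ 5 2 * progProd q⁻¹ 5 3 * progProd q⁻¹ 5 5 := by
  have hx0 : 0 < q⁻¹ := by positivity
  have hx1 : q⁻¹ < 1 := inv_lt_one_of_one_lt₀ hq
  have e := fun b => tendsto_progProd hx0 hx1 (a := 5) (by norm_num) b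
  refine tprod_eq_of_tendsto_five (multipliable_ite_one_sub hq _ 0) (by simp)
    (((e 2).mul (e 3)).mul (e 5) |>.congr fun N => ?_)
  rw [← prod_mul_distrib, ← prod_mul_distrib]
  refine prod_congr rfl fun i _ => ?_
  rw [if_neg (by omega), if_pos (by omega), if_pos (by omega), if_neg (by omega),
    if_pos (by omega)]
  simp only [one_div, inv_pow, mul_one, one_mul, Nat.sub_zero]

lemma tprod_mod_five_two_three_sub_one (hq : 1 < q) :
    (∏' r : ℕ, if 1 ≤ r ∧ (r % 5 = 0 ∨ r % 5 = 2 ∨ r % 5 = 3) then 1 - 1 / q ^ (r - 1) else 1) =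
      progProd q⁻¹ 5 1 * progProd q⁻¹ 5 2 * progProd q⁻¹ 5 4 := by
  have hx0 : 0 < q⁻¹ := by positivity
  have hx1 : q⁻¹ < 1 := inv_lt_one_of_one_lt₀ hq
  have e := fun b => tendsto_progProd hx0 hx1 (a := 5) (by norm_num) b
  refine tprod_eq_of_tendsto_five (multipliable_ite_one_sub hq _ 1) (by simp)
    (((e 1).mul (e 2)).mul (e 4) |>.congr fun N => ?_)
  rw [← prod_mul_distrib, ← prod_mul_distrib]
  refine prod_congr rfl fun i _ => ?_
  rw [if_neg (by omega), if_pos (by omega), if_pos (by omega), if_neg (by omega),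
    if_pos (by omega)]
  simp only [one_div, inv_pow, mul_one, one_mul, Nat.add_succ_sub_one]

end ModFive

/-- As `n → ∞`, the proportion of semisimple elements of `A(n,q)` converges to
`[∏___{r≡0,±1 (5)} (1 - 1/q^r)] [∏_{r≡0,±2 (5)} (1 - 1/q^{r-1})] / [∏_{r≡0,±2 (5)} (1 - 1/q^r)]²`,
all products being over `r ≥ 1` in the indicated residue classes mod `5`. -/
theorem affine_semisimple_limit (F : Type) [Field F] [Fintype F] (q : ℕ)
    (hq : q = Fintype.card F) :
    Filter.Tendsto (fun n : ℕ => ssA F n) Filter.atTop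
      (nhds
        ((∏' r : ℕ, if 1 ≤ r ∧ (r % 5 = 0 ∨ r % 5 = 1 ∨ r % 5 = 4)
            then 1 - 1 / (q : ℝ) ^ r else 1) *
          (∏' r : ℕ, if 1 ≤ r ∧ (r % 5 = 0 ∨ r % 5 = 2 ∨ r % 5 = 3)
            then 1 - 1 / (q : ℝ) ^ (r - 1) else 1) /
          (∏' r : ℕ, if 1 ≤ r ∧ (r % 5 = 0 ∨ r % 5 = 2 ∨ r % 5 = 3)
            then 1 - 1 / (q : ℝ) ^ r else 1) ^ 2)) := by
  have hq1 : (1 : ℝ) < q := by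
    rw [hq]
    exact_mod_cast Fintype.one_lt_card
  rw [tprod_mod_five_one_four hq1, tprod_mod_five_two_three hq1,
    tprod_mod_five_two_three_sub_one hq1]
  have hL := tendsto_ssA F (tendsto_evalAt_affSeries (F := F))
  rw [Nat.card_eq_fintype_card, ← hq] at hL
  have hpos : ∀ b : ℕ, b ≠ 0 → progProd (q : ℝ)⁻¹ 5 b ≠ 0 := fun b hb =>
    (progProd_pos (by positivity) (inv_lt_one_of_one_lt₀ hq1) (by norm_num) hb).ne'
  have e2 := hpos 2 (by norm_num)
  have e3 := hpos 3 (by norm_num)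
  have e5 := hpos 5 (by norm_num)
  convert hL using 2
  field_simp
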